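/- arXiv:math/0212272 — 2 statements merged into one kernel-verified Lean document; each statement's English description precedes it below -/
import Mathlib

section
/- Fix p ≥ 1, β = (β_1,...,β_p) ∈ k^p with β_i - β_j ∉ ℤ for i ≠ j, and a monic polynomial γ(u) of degree 2p. Define a k-vector space M with basis {ξ^{(k)} : k ∈ ℤ^p} and operators by: T_{22}(u)ξ^{(k)} = Π_{i=1}^p (u + β_i + k_i) ξ^{(k)}; T_{21}(u)ξ^{(k)} = Σ_i A_i(k) · [Π_{j≠i}(u+β_j+k_j) / Π_{j≠i}(β_j - β_i + k_j - k_i)] ξ^{(k+δ_i)}; T_{12}(u)ξ^{(k)} = Σ_i B_i(k) · [Π_{j≠i}(u+β_j+k_j) / Π_{j≠i}(β_j - β_i + k_j - k_i)] ξ^{(k-δ_i)}; and T_{11}(u) determined by (T_{11}(u)T_{22}(u-1) - T_{21}(u)T_{12}(u-1))ξ^{(k)} = γ(u)ξ^{(k)}; where A_i(k) = 1 if k_i ≥ 0 and -γ(-β_i - k_i) if k_i < 0, and B_i(k) = -γ(-β_i - k_i + 1) if k_i > 0 and 1 if k_i ≤ 0. Then these operators satisfy the defining relations of Y_p(gl_2),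 making M a Y_p(gl_2)-module. -/
open Polynomial

/-- Generator index for the level-`p` Yangian: `(i, j, k)` with `k : Fin p` encoding
the superscript `k+1`. -/
abbrev YGen (p : ℕ) := Fin 2 × Fin 2 × Fin p

/-- The free-algebra version of the generator `t_{ij}^{(r)}`, with the conventions
`t_{ij}^{(0)} = δ_{ij}` and `t_{ij}^{(r)} = 0` for `r > p`. -/
noncomputable def tF (K : Type) [Field K] (p : ℕ) (i j : Fin 2) (r : ℕ) :
    FreeAlgebra K (YGen p) :=
  if h0 : r = 0 then (if i = j then 1 else 0)
  else if h : r ≤ p then FreeAlgebra.ι K (i, j, (⟨r - 1, by omega⟩ : Fin p)) else 0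

/-- The defining relations of the level-`p` Yangian:
`[t_{ij}^{(r)}, t_{kl}^{(s)}] = Σ_{a=1}^{min(r,s)} (t_{kj}^{(a-1)} t_{il}^{(r+s-a)} -
t_{kj}^{(r+s-a)} t_{il}^{(a-1)})`. -/
inductive YRel (K : Type) [Field K] (p : ℕ) :
    FreeAlgebra K (YGen p) → FreeAlgebra K (YGen p) → Prop
  | rel (i j k l : Fin 2) (r s : ℕ) (hr : 1 ≤ r) (hr' : r ≤ p) (hs : 1 ≤ s) (hs' : s ≤ p) :
      YRel K p (tF K p i j r * tF K p k l s - tF K p k l s * tF K p i j r)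
        (∑ a ∈ Finset.Icc 1 (min r s),
          (tF K p k j (a - 1) * tF K p i l (r + s - a)
            - tF K p k j (r + s - a) * tF K p i l (a - 1)))

/-- The level-`p` Yangian `Y_p(gl_2)`. -/
abbrev Yp (K : Type) [Field K] (p : ℕ) := RingQuot (YRel K p)

/-- The generator `t_{ij}^{(r)}` of `Y_p(gl_2)` (matrix indices `0,1` stand for `1,2`). -/
noncomputable def tY (K : Type) [Field K] (p : ℕ) (i j : Fin 2) (r : ℕ) : Yp K p :=
  RingQuot.mkAlgHom K (YRel K p) (tF K p i j r)

/-- The generating polynomial `T_{ij}(u) = δ_{ij} u^p + Σ_{k=1}^p t_{ij}^{(k)} u^{p-k}`. -/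
noncomputable def TY (K : Type) [Field K] (p : ℕ) (i j : Fin 2) : Polynomial (Yp K p) :=
  (if i = j then X ^ p else 0) + ∑ k ∈ Finset.Icc 1 p, C (tY K p i j k) * X ^ (p - k)

/-- The quantum determinant `D(u) = T_{11}(u) T_{22}(u-1) - T_{21}(u) T_{12}(u-1)`. -/
noncomputable def DY (K : Type) [Field K] (p : ℕ) : Polynomial (Yp K p) :=
  TY K p 0 0 * (TY K p 1 1).comp (X - 1) - TY K p 1 0 * (TY K p 0 1).comp (X - 1)

/-- The coefficient `d_i` of the quantum determinant: `D(u) = u^{2p} + Σ_i d_i u^{2p-i}`. -/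
noncomputable def dY (K : Type) [Field K] (p : ℕ) (i : ℕ) : Yp K p :=
  (DY K p).coeff (2 * p - i)

/-- The commutative subalgebra `Γ` generated by `t_{22}^{(1)},…,t_{22}^{(p)}` and
`d_1,…,d_{2p}`. -/
noncomputable def Gam (K : Type) [Field K] (p : ℕ) : Subalgebra K (Yp K p) :=
  Algebra.adjoin K
    ({x | ∃ k ∈ Finset.Icc 1 p, x = tY K p 1 1 k} ∪
     {x | ∃ i ∈ Finset.Icc 1 (2 * p), x = dY K p i})

open Polynomial

/-- The underlying space of the universal module: the vector space with basis
`ξ^(k)`, `k ∈ ℤ^p`. -/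
abbrev UM (K : Type) [Field K] (p : ℕ) := (Fin p → ℤ) →₀ K

/-- The basis vector `ξ^(k)`. -/
noncomputable def xi (K : Type) [Field K] (p : ℕ) (k : Fin p → ℤ) : UM K p :=
  Finsupp.single k 1

/-- The coefficient `A_i(k)`. -/
noncomputable def Acoef (K : Type) [Field K] (γ : Polynomial K) {p : ℕ} (β : Fin p → K)
    (i : Fin p) (k : Fin p → ℤ) : K :=
  if 0 ≤ k i then 1 else -γ.eval (-β i - (k i : K))

/-- The coefficient `B_i(k)`. -/
noncomputable def Bcoef (K : Type) [Field K] (γ : Polynomial K) {p : ℕ} (β : Fin p → K)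
    (i : Fin p) (k : Fin p → ℤ) : K :=
  if 0 < k i then -γ.eval (-β i - (k i : K) + 1) else 1

/-- The Lagrange-type coefficient `Π_(j≠i)(c+β_j+k_j) / Π_(j≠i)(β_j-β_i+k_j-k_i)`. -/
noncomputable def Lcoef (K : Type) [Field K] {p : ℕ} (β : Fin p → K) (c : K)
    (i : Fin p) (k : Fin p → ℤ) : K :=
  (∏ j ∈ Finset.univ.erase i, (c + β j + (k j : K))) /
    (∏ j ∈ Finset.univ.erase i, (β j - β i + (k j : K) - (k i : K)))

namespace YangianModule

section RTT

variable {F A : Type*} [Field F] [Ring A] [Algebra F A]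

/-- The `(i, j; k, l)` entry of the RTT relation, at the points `u` and `v`. -/
def RTT (T : Fin 2 → Fin 2 → F → A) (i j k l : Fin 2) (u v : F) : Prop :=
  (u - v) • (T i j u * T k l v - T k l v * T i j u) = T k j u * T i l v - T k j v * T i l u

/-- The relations not involving `T_11`, the relation between `T_21` and `T_12`, and the quantum
determinant relation with `T_22` cancellable at the points of `G`. -/
structure GaussData (T : Fin 2 → Fin 2 → F → A) (G : Set F) (γ : F → F) : Prop where
  dd : ∀ u v, T 1 1 u * T 1 1 v = T 1 1 v * T 1 1 u
  cc : ∀ u v, T 1 0 u * T 1 0 v = T 1 0 v * T 1 0 u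
  bb : ∀ u v, T 0 1 u * T 0 1 v = T 0 1 v * T 0 1 u
  dc : ∀ u v, (u - v) • (T 1 1 u * T 1 0 v - T 1 0 v * T 1 1 u) =
    T 1 1 u * T 1 0 v - T 1 1 v * T 1 0 u
  dc' : ∀ u v, (u - v) • (T 1 1 u * T 1 0 v - T 1 0 v * T 1 1 u) =
    T 1 0 v * T 1 1 u - T 1 0 u * T 1 1 v
  db : ∀ u v, (u - v) • (T 1 1 u * T 0 1 v - T 0 1 v * T 1 1 u) =
    T 0 1 u * T 1 1 v - T 0 1 v * T 1 1 u
  db' : ∀ u v, (u - v) • (T 1 1 u * T 0 1 v - T 0 1 v * T 1 1 u) =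
    T 1 1 v * T 0 1 u - T 1 1 u * T 0 1 v
  cb : ∀ u v, (u - v) • (T 1 0 u * T 0 1 v - T 0 1 v * T 1 0 u) =
    T 0 0 u * T 1 1 v - T 0 0 v * T 1 1 u
  qdet : ∀ u, T 0 0 u * T 1 1 (u - 1) = algebraMap F A (γ u) + T 1 0 u * T 0 1 (u - 1)
  sub_one_mem : ∀ u ∈ G, u - 1 ∈ G
  cancel_left : ∀ u ∈ G, ∀ x y : A, T 1 1 u * x = T 1 1 u * y → x = y
  cancel_right : ∀ u ∈ G, ∀ x y : A, x * T 1 1 u = y * T 1 1 u → x = y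

theorem RTT.swap {T : Fin 2 → Fin 2 → F → A} {i j k l : Fin 2} {u v : F} (huv : u ≠ v)
    (h : RTT T i j k l v u) (h₁ : RTT T k j i l u v) (h₂ : RTT T k j i l v u) :
    RTT T k l i j u v := by
  unfold RTT at *
  have hw : u - v ≠ 0 := sub_ne_zero.2 huv
  apply smul_right_injective A hw
  simp only [smul_sub] at *
  have e : (u - v) • (T k j u * T i l v) - (u - v) • (T i l v * T k j u) =
    (u - v) • (T k j v * T i l u) - (u - v) • (T i l u * T k j v) := by
    linear_combination (norm := module) h₁ + h₂
  have h' := congrArg (fun z => (u - v) • z) h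
  simp only [smul_sub] at h'
  linear_combination (norm := module) h' - e

theorem RTT.swap' {T : Fin 2 → Fin 2 → F → A} {i j k l : Fin 2} {u v : F} (huv : u ≠ v)
    (h : RTT T i j k l v u) (h₁ : RTT T i l k j u v) (h₂ : RTT T i l k j v u) :
    RTT T k l i j u v := by
  unfold RTT at *
  have hw : u - v ≠ 0 := sub_ne_zero.2 huv
  apply smul_right_injective A hw
  simp only [smul_sub] at *
  have e : (u - v) • (T i l u * T k j v) - (u - v) • (T k j v * T i l u) =
    (u - v) • (T i l v * T k j u) - (u - v) • (T k j u * T i l v) := by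
    linear_combination (norm := module) h₁ + h₂
  have h' := congrArg (fun z => (u - v) • z) h
  simp only [smul_sub] at h'
  linear_combination (norm := module) h' - e

namespace GaussData

variable {T : Fin 2 → Fin 2 → F → A} {G : Set F} {γ : F → F}

theorem rtt_ad (H : GaussData T G γ) {u : F} (hu : u ∈ G) (v : F) : RTT T 0 0 1 1 u v := by
  apply H.cancel_right _ (H.sub_one_mem u hu)
  have e₁ := congrArg (fun z => z * T 1 1 v) (H.qdet u)
  have e₂ := congrArg (fun z => T 1 1 v * z) (H.qdet u)
  have e₃ := congrArg (fun z => T 0 0 u * z) (H.dd v (u - 1))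
  have e₄ := congrArg (fun z => T 1 0 u * z) (H.db v (u - 1))
  have e₅ := congrArg (fun z => z * T 0 1 (u - 1)) (H.dc' v u)
  have e₆ := congrArg (fun z => T 1 0 v * z) (H.db u (u - 1))
  simp only [sub_mul, mul_sub, add_mul, mul_add, smul_sub, smul_mul_assoc, mul_smul_comm,
    mul_assoc, Algebra.algebraMap_eq_smul_one, one_mul, mul_one] at *
  linear_combination (norm := module)
    (u - v) • e₃ + (u - v) • e₁ - (u - v) • e₂ + e₄ + e₅ - e₆

theorem rtt_bc (H : GaussData T G γ) {u v : F} (hu : u ∈ G) (hv : v ∈ G) (huv : u ≠ v) :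
    RTT T 0 1 1 0 u v :=
  RTT.swap huv (H.cb v u) (H.rtt_ad hu v) (H.rtt_ad hv u)

theorem rtt_da (H : GaussData T G γ) {u v : F} (hv : v ∈ G) (huv : u ≠ v) :
    RTT T 1 1 0 0 u v :=
  RTT.swap huv (H.rtt_ad hv u) (H.cb u v) (H.cb v u)

theorem qdet' (H : GaussData T G γ) {u : F} (hu : u ∈ G) :
    T 1 1 (u - 1) * T 0 0 u = algebraMap F A (γ u) + T 1 0 (u - 1) * T 0 1 u := by
  have e₁ := H.rtt_ad hu (u - 1)
  have e₂ := H.qdet u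
  unfold RTT at e₁
  linear_combination (norm := module) e₂ - e₁

theorem rtt_ac (H : GaussData T G γ) {u v : F} (hu : u ∈ G) (hv : v ∈ G) (huv : u ≠ v) :
    RTT T 0 0 1 0 u v := by
  apply H.cancel_left _ (H.sub_one_mem u hu)
  have e₁ := congrArg (fun z => z * T 1 0 v) (H.qdet' hu)
  have e₂ := congrArg (fun z => T 1 0 v * z) (H.qdet' hu)
  have e₃ := congrArg (fun z => z * T 0 0 u) (H.dc' (u - 1) v)
  have e₄ := H.rtt_bc hu hv huv
  unfold RTT at e₄
  have e₄ := congrArg (fun z => T 1 0 (u - 1) * z) e₄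
  have e₅ := congrArg (fun z => z * T 0 0 v) (H.dc u (u - 1))
  have e₆ := congrArg (fun z => z * T 0 1 u) (H.cc (u - 1) v)
  simp only [sub_mul, mul_sub, add_mul, mul_add, smul_sub, smul_mul_assoc, mul_smul_comm,
    mul_assoc, Algebra.algebraMap_eq_smul_one, one_mul, mul_one] at *
  linear_combination (norm := module)
    (u - v) • e₁ - e₃ - (u - v) • e₂ + e₄ + (u - v) • e₆ - e₅

theorem rtt_ca (H : GaussData T G γ) {u v : F} (hu : u ∈ G) (hv : v ∈ G) (huv : u ≠ v) :
    RTT T 1 0 0 0 u v :=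
  RTT.swap' huv (H.rtt_ac hv hu huv.symm) (H.rtt_ac hu hv huv) (H.rtt_ac hv hu huv.symm)

theorem rtt_ab (H : GaussData T G γ) {u : F} (hu : u ∈ G) (v : F) : RTT T 0 0 0 1 u v := by
  apply H.cancel_right _ (H.sub_one_mem u hu)
  have e₁ := congrArg (fun z => z * T 0 1 v) (H.qdet u)
  have e₂ := congrArg (fun z => T 0 1 v * z) (H.qdet u)
  have e₃ := congrArg (fun z => T 0 0 u * z) (H.db' (u - 1) v)
  have e₄ := congrArg (fun z => z * T 0 1 (u - 1)) (H.cb u v)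
  have e₅ := congrArg (fun z => T 0 0 v * z) (H.db u (u - 1))
  have e₆ := congrArg (fun z => T 1 0 u * z) (H.bb (u - 1) v)
  simp only [sub_mul, mul_sub, add_mul, mul_add, smul_sub, smul_mul_assoc, mul_smul_comm,
    mul_assoc, Algebra.algebraMap_eq_smul_one, one_mul, mul_one] at *
  linear_combination (norm := module)
    (u - v) • e₁ - e₃ - (u - v) • e₂ + e₄ + (u - v) • e₆ - e₅

theorem rtt_ba (H : GaussData T G γ) {u v : F} (hu : u ∈ G) (hv : v ∈ G) (huv : u ≠ v) :
    RTT T 0 1 0 0 u v :=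
  RTT.swap huv (H.rtt_ab hv u) (H.rtt_ab hu v) (H.rtt_ab hv u)

theorem commute_aa (H : GaussData T G γ) {u v : F} (hu : u ∈ G) (hv : v ∈ G) (huv : u ≠ v)
    (huv' : u - v + 1 ≠ 0) : T 0 0 u * T 0 0 v = T 0 0 v * T 0 0 u := by
  have hv' := H.sub_one_mem v hv
  apply H.cancel_right _ hv'
  apply smul_right_injective A huv'
  have e₁ := congrArg (fun z => T 0 0 u * z) (H.qdet v)
  have e₂ := congrArg (fun z => z * T 0 0 u) (H.qdet v)
  have e₃ := H.rtt_ad hu (v - 1)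
  have e₄ := H.rtt_ca hv hu huv.symm
  have e₅ := H.rtt_ab hu (v - 1)
  have e₆ := H.rtt_ac hv hv' fun e => one_ne_zero (sub_eq_self.1 e.symm)
  unfold RTT at e₃ e₄ e₅ e₆
  have e₃ := congrArg (fun z => T 0 0 v * z) e₃
  have e₄ := congrArg (fun z => z * T 0 1 (v - 1)) e₄
  have e₅ := congrArg (fun z => T 1 0 v * z) e₅
  have e₆ := congrArg (fun z => z * T 0 1 u) e₆
  simp only [sub_mul, mul_sub, add_mul, mul_add, smul_sub, smul_mul_assoc, mul_smul_comm,
    mul_assoc, Algebra.algebraMap_eq_smul_one, one_mul, mul_one] at *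
  linear_combination (norm := module)
    (u - v + 1) • e₁ - (u - v + 1) • e₂ - e₃ + e₄ + e₅ + e₆

theorem rtt (H : GaussData T G γ) {u v : F} (hu : u ∈ G) (hv : v ∈ G) (huv : u ≠ v)
    (huv' : u - v + 1 ≠ 0) : ∀ i j k l, RTT T i j k l u v := by
  have self {i j : Fin 2} (h : T i j u * T i j v = T i j v * T i j u) : RTT T i j i j u v := by
    rw [RTT, h, sub_self, smul_zero]
  have dc' : RTT T 1 0 1 1 u v := by
    have := H.dc' v u
    unfold RTT
    linear_combination (norm := module) this
  have db' : RTT T 0 1 1 1 u v := by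
    have := H.db' v u
    unfold RTT
    linear_combination (norm := module) this
  simp only [Fin.forall_fin_two]
  exact ⟨⟨⟨⟨self (H.commute_aa hu hv huv huv'), H.rtt_ab hu v⟩, H.rtt_ac hu hv huv,
    H.rtt_ad hu v⟩, ⟨H.rtt_ba hu hv huv, self (H.bb u v)⟩, H.rtt_bc hu hv huv, db'⟩,
    ⟨⟨H.rtt_ca hu hv huv, H.cb u v⟩, self (H.cc u v), dc'⟩,
    ⟨H.rtt_da hv huv, H.db u v⟩, H.dc u v, self (H.dd u v)⟩

end GaussData

end RTT

section Operators

open Finset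

variable {F : Type} [Field F] {p : ℕ}

/-- The shifted parameter `β_i + k_i`. -/
def node (β : Fin p → F) (k : Fin p → ℤ) (i : Fin p) : F :=
  β i + (k i : F)

/-- The product `Π_{j ≠ i} (u + β_j + k_j)`. -/
def prodErase (β : Fin p → F) (k : Fin p → ℤ) (i : Fin p) (u : F) : F :=
  ∏ j ∈ univ.erase i, (u + node β k j)

/-- The product `Π_{l ≠ i, j} (u + β_l + k_l)`. -/
def prodErase₂ (β : Fin p → F) (k : Fin p → ℤ) (i j : Fin p) (u : F) : F :=
  ∏ l ∈ (univ.erase i).erase j, (u + node β k l)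

/-- The eigenvalue `Π_i (u + β_i + k_i)` of `T_22(u)`. -/
def prodAll (β : Fin p → F) (k : Fin p → ℤ) (u : F) : F :=
  ∏ i, (u + node β k i)

@[simp]
theorem node_add_single_self (β : Fin p → F) (k : Fin p → ℤ) (i : Fin p) (s : ℤ) :
    node β (k + Pi.single i s) i = node β k i + s := by
  simp [node, add_assoc]

theorem node_add_single_of_ne (β : Fin p → F) (k : Fin p → ℤ) {i j : Fin p} (h : i ≠ j) (s : ℤ) :
    node β (k + Pi.single j s) i = node β k i := by
  simp [node, Pi.single_eq_of_ne h]

theorem prodAll_eq (β : Fin p → F) (k : Fin p → ℤ) (i : Fin p) (u : F) :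
    prodAll β k u = (u + node β k i) * prodErase β k i u :=
  (mul_prod_erase univ (fun j => u + node β k j) (mem_univ i)).symm

theorem prodErase_eq (β : Fin p → F) (k : Fin p → ℤ) {i j : Fin p} (h : j ≠ i) (u : F) :
    prodErase β k i u = (u + node β k j) * prodErase₂ β k i j u :=
  (mul_prod_erase (univ.erase i) (fun j => u + node β k j)
    (mem_erase.2 ⟨h, mem_univ j⟩)).symm

theorem prodErase₂_comm (β : Fin p → F) (k : Fin p → ℤ) (i j : Fin p) (u : F) :
    prodErase₂ β k i j u = prodErase₂ β k j i u := by
  rw [prodErase₂, prodErase₂, erase_right_comm]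

@[simp]
theorem prodErase_add_single (β : Fin p → F) (k : Fin p → ℤ) (i : Fin p) (s : ℤ) (u : F) :
    prodErase β (k + Pi.single i s) i u = prodErase β k i u :=
  prod_congr rfl fun j hj => by rw [node_add_single_of_ne β k (ne_of_mem_erase hj)]

theorem prodErase₂_add_single (β : Fin p → F) (k : Fin p → ℤ) (i j : Fin p) (s : ℤ)
    (u : F) : prodErase₂ β (k + Pi.single j s) i j u = prodErase₂ β k i j u :=
  prod_congr rfl fun l hl => by rw [node_add_single_of_ne β k (ne_of_mem_erase hl)]

theorem prodAll_add_single (β : Fin p → F) (k : Fin p → ℤ) (i : Fin p) (s : ℤ) (u : F) :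
    prodAll β (k + Pi.single i s) u = (u + (node β k i + s)) * prodErase β k i u := by
  rw [prodAll_eq β _ i, prodErase_add_single, node_add_single_self]

theorem Lcoef_eq (β : Fin p → F) (u : F) (i : Fin p) (k : Fin p → ℤ) :
    Lcoef F β u i k = prodErase β k i u / prodErase β k i (-node β k i) := by
  rw [Lcoef, prodErase, prodErase]
  congr 1 <;> exact prod_congr rfl fun j _ => by simp only [node]; ring

theorem Lcoef_add_single_self (β : Fin p → F) (u : F) (i : Fin p) (k : Fin p → ℤ) (s : ℤ) :
    Lcoef F β u i (k + Pi.single i s) =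
      prodErase β k i u / prodErase β k i (-(node β k i + s)) := by
  rw [Lcoef_eq, prodErase_add_single, prodErase_add_single, node_add_single_self]

theorem Lcoef_eq_of_ne (β : Fin p → F) (u : F) {i j : Fin p} (h : j ≠ i) (k : Fin p → ℤ) :
    Lcoef F β u i k = (u + node β k j) * prodErase₂ β k i j u /
      ((node β k j - node β k i) * prodErase₂ β k i j (-node β k i)) := by
  rw [Lcoef_eq, prodErase_eq β k h, prodErase_eq β k h, neg_add_eq_sub]

theorem Lcoef_add_single_of_ne (β : Fin p → F) (u : F) {i j : Fin p} (h : j ≠ i)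
    (k : Fin p → ℤ) (s : ℤ) :
    Lcoef F β u i (k + Pi.single j s) = (u + node β k j + s) * prodErase₂ β k i j u /
      ((node β k j - node β k i + s) * prodErase₂ β k i j (-node β k i)) := by
  rw [Lcoef_eq_of_ne β u h, prodErase₂_add_single, prodErase₂_add_single, node_add_single_self,
    node_add_single_of_ne β k h.symm, add_sub_right_comm, add_assoc]

/-- No two of the parameters differ by an integer. -/
def Generic (β : Fin p → F) : Prop :=
  ∀ i j, i ≠ j → ∀ m : ℤ, β i - β j ≠ (m : F)

namespace Generic

variable {β : Fin p → F}

theorem node_sub_add_ne_zero (hβ : Generic β) {i j : Fin p} (h : i ≠ j) (k : Fin p → ℤ)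
    (s : ℤ) :
    node β k i - node β k j + s ≠ 0 := fun e =>
  hβ i j h (k j - k i - s) <| by rw [node, node] at e; push_cast; linear_combination e

theorem node_sub_ne_zero (hβ : Generic β) {i j : Fin p} (h : i ≠ j) (k : Fin p → ℤ) :
    node β k i - node β k j ≠ 0 := by
  simpa using hβ.node_sub_add_ne_zero h k 0

theorem prodErase_ne_zero (hβ : Generic β) (k : Fin p → ℤ) (i : Fin p) (s : ℤ) :
    prodErase β k i (-(node β k i + s)) ≠ 0 :=
  prod_ne_zero_iff.2 fun j hj e => hβ.node_sub_add_ne_zero (ne_of_mem_erase hj) k (-s) <| by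
    push_cast
    linear_combination e

theorem prodErase₂_ne_zero (hβ : Generic β) (k : Fin p → ℤ) (i j : Fin p) :
    prodErase₂ β k i j (-node β k i) ≠ 0 :=
  prod_ne_zero_iff.2 fun l hl e =>
    hβ.node_sub_ne_zero (ne_of_mem_erase (mem_of_mem_erase hl)) k <| by
      linear_combination e

end Generic

/-- The operator `T_22(u)`. -/
noncomputable def opD (β : Fin p → F) (u : F) : Module.End F (UM F p) :=
  Finsupp.linearCombination F fun k => prodAll β k u • xi F p k

/-- The operator raising one of the coordinates by `s`; it is `T_21(u)` for `s = 1` and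
`T_12(u)` for `s = -1`. -/
noncomputable def opS (β : Fin p → F) (f : Fin p → ℤ → F) (s : ℤ) (u : F) :
    Module.End F (UM F p) :=
  Finsupp.linearCombination F fun k =>
    ∑ i, (f i (k i) * Lcoef F β u i k) • xi F p (k + Pi.single i s)

/-- The matrix coefficients of `T_11(u) - T_22(u)`. -/
noncomputable def Ecoef (β : Fin p → F) (A B : Fin p → ℤ → F) (k : Fin p → ℤ) (i j : Fin p)
    (u : F) : F :=
  if i = j then
    Lcoef F β u i k * (A i (k i) * B i (k i + 1) / prodErase β k i (-(node β k i + 1)) -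
      A i (k i - 1) * B i (k i) / prodErase β k i (-(node β k i - 1)))
  else -(A i (k i) * B j (k j)) * prodErase₂ β k i j u /
    (prodErase₂ β k i j (-node β k i) * prodErase₂ β k j i (-node β k j) *
      ((node β k i - node β k j) * (node β k i - node β k j + 1)))

/-- The operator `T_11(u)`. -/
noncomputable def opA (β : Fin p → F) (A B : Fin p → ℤ → F) (u : F) : Module.End F (UM F p) :=
  Finsupp.linearCombination F fun k => prodAll β k u • xi F p k +
    ∑ i, ∑ j, Ecoef β A B k i j u • xi F p (k + Pi.single i 1 + Pi.single j (-1))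

@[simp]
theorem opD_xi (β : Fin p → F) (u : F) (k : Fin p → ℤ) :
    opD β u (xi F p k) = prodAll β k u • xi F p k := by
  rw [opD, xi, Finsupp.linearCombination_single, one_smul, xi]

@[simp]
theorem opS_xi (β : Fin p → F) (f : Fin p → ℤ → F) (s : ℤ) (u : F) (k : Fin p → ℤ) :
    opS β f s u (xi F p k) =
      ∑ i, (f i (k i) * Lcoef F β u i k) • xi F p (k + Pi.single i s) := by
  rw [opS, xi, Finsupp.linearCombination_single, one_smul]

@[simp]
theorem opA_xi (β : Fin p → F) (A B : Fin p → ℤ → F) (u : F) (k : Fin p → ℤ) :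
    opA β A B u (xi F p k) = prodAll β k u • xi F p k +
      ∑ i, ∑ j, Ecoef β A B k i j u • xi F p (k + Pi.single i 1 + Pi.single j (-1)) := by
  rw [opA, xi, Finsupp.linearCombination_single, one_smul, xi]

theorem end_ext {f g : Module.End F (UM F p)} (h : ∀ k, f (xi F p k) = g (xi F p k)) : f = g :=
  Finsupp.lhom_ext' fun k => LinearMap.ext_ring (h k)

theorem opD_comm (β : Fin p → F) (u v : F) : opD β u * opD β v = opD β v * opD β u :=
  end_ext fun k => by simp [smul_smul, mul_comm]

theorem opD_opS (β : Fin p → F) (f : Fin p → ℤ → F) (s : ℤ) (u v : F) :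
    (u - v) • (opD β u * opS β f s v - opS β f s v * opD β u) =
      (s : F) • (opD β u * opS β f s v - opD β v * opS β f s u) :=
  end_ext fun k => by
    simp only [LinearMap.smul_apply, LinearMap.sub_apply, Module.End.mul_apply, opD_xi, opS_xi,
      map_sum, map_smul, smul_sum, smul_smul, ← sum_sub_distrib, ← sub_smul]
    refine sum_congr rfl fun i _ => ?_
    rw [prodAll_add_single, prodAll_add_single, prodAll_eq β k i, Lcoef_eq, Lcoef_eq]
    congr 1
    ring

theorem opD_opS' (β : Fin p → F) (f : Fin p → ℤ → F) (s : ℤ) (u v : F) :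
    (u - v) • (opD β u * opS β f s v - opS β f s v * opD β u) =
      (s : F) • (opS β f s v * opD β u - opS β f s u * opD β v) :=
  end_ext fun k => by
    simp only [LinearMap.smul_apply, LinearMap.sub_apply, Module.End.mul_apply, opD_xi, opS_xi,
      map_sum, map_smul, smul_sum, smul_smul, ← sum_sub_distrib, ← sub_smul]
    refine sum_congr rfl fun i _ => ?_
    rw [prodAll_add_single, prodAll_eq β k i, prodAll_eq β k i, Lcoef_eq, Lcoef_eq]
    congr 1
    ring

theorem sum_eq_zero_of_antisymm {M : Type*} [AddCommGroup M] (g : Fin p → Fin p → M)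
    (h : ∀ i, g i i = 0) (h' : ∀ i j, i ≠ j → g i j + g j i = 0) : ∑ i, ∑ j, g i j = 0 := by
  rw [← sum_product']
  refine sum_involution (fun x _ => (x.2, x.1)) (fun x _ => ?_) (fun x _ hx e => hx ?_)
    (fun _ _ => by simp) (fun _ _ => rfl)
  · obtain ⟨i, j⟩ := x
    by_cases hij : i = j
    · subst hij
      simp [h]
    · exact h' i j hij
  · obtain ⟨i, j⟩ := x
    obtain rfl : j = i := (Prod.ext_iff.1 e).1
    exact h j

theorem opS_comm {β : Fin p → F} (hβ : Generic β) (f : Fin p → ℤ → F) (s : ℤ) (u v : F) :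
    opS β f s u * opS β f s v = opS β f s v * opS β f s u := by
  rw [← sub_eq_zero]
  refine end_ext fun k => ?_
  simp only [LinearMap.sub_apply, Module.End.mul_apply, opS_xi, map_sum, map_smul,
    smul_sum, smul_smul, ← sum_sub_distrib, ← sub_smul, LinearMap.zero_apply]
  refine sum_eq_zero_of_antisymm _ (fun i => ?_) fun i j hij => ?_
  · simp only [Lcoef_eq β _ i k, Lcoef_add_single_self]
    convert zero_smul F _
    ring
  · rw [add_right_comm k (Pi.single j s), ← add_smul]
    convert zero_smul F _
    simp only [Pi.add_apply, Pi.single_eq_of_ne hij, Pi.single_eq_of_ne hij.symm, add_zero,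
      Lcoef_eq_of_ne β _ hij k, Lcoef_eq_of_ne β _ hij.symm k, Lcoef_add_single_of_ne β _ hij,
      Lcoef_add_single_of_ne β _ hij.symm, prodErase₂_comm β k j i]
    have h₁ := hβ.prodErase₂_ne_zero k i j
    have h₂ := hβ.prodErase₂_ne_zero k j i
    rw [prodErase₂_comm] at h₂
    have h₃ := hβ.node_sub_ne_zero hij k
    have h₃' := hβ.node_sub_ne_zero hij.symm k
    have h₄ := hβ.node_sub_add_ne_zero hij k s
    have h₅ := hβ.node_sub_add_ne_zero hij.symm k s
    field_simp
    ring

theorem opS_opS {β : Fin p → F} (hβ : Generic β) (A B : Fin p → ℤ → F) (u v : F) :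
    (u - v) • (opS β A 1 u * opS β B (-1) v - opS β B (-1) v * opS β A 1 u) =
      opA β A B u * opD β v - opA β A B v * opD β u := by
  refine end_ext fun k => ?_
  simp only [LinearMap.smul_apply, LinearMap.sub_apply, Module.End.mul_apply, opD_xi, opS_xi,
    opA_xi, map_sum, map_smul, smul_add, smul_sum, smul_smul]
  rw [sum_comm, mul_comm (prodAll β k u), add_sub_add_left_eq_sub]
  simp only [smul_sub, smul_sum, smul_smul, ← sum_sub_distrib]
  refine sum_congr rfl fun i _ => sum_congr rfl fun j _ => ?_
  rw [add_right_comm k (Pi.single j (-1)), ← sub_smul, ← sub_smul]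
  congr 1
  by_cases hij : i = j
  · subst hij
    simp only [Ecoef, if_true, Lcoef_eq β _ i k, Lcoef_add_single_self, prodAll_eq β k i,
      Pi.add_apply, Pi.single_eq_same, Int.cast_neg, Int.cast_one, ← sub_eq_add_neg]
    ring
  · have hji := Ne.symm hij
    simp only [Ecoef, if_neg hij, Pi.add_apply, Pi.single_eq_of_ne hij, Pi.single_eq_of_ne hji,
      add_zero, Lcoef_eq_of_ne β _ hij k, Lcoef_eq_of_ne β _ hji k, Lcoef_add_single_of_ne β _ hij,
      Lcoef_add_single_of_ne β _ hji, prodErase₂_comm β k j i, prodAll_eq β k i,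
      prodErase_eq β k hji, Int.cast_neg, Int.cast_one]
    have h₁ := hβ.prodErase₂_ne_zero k i j
    have h₂ := hβ.prodErase₂_ne_zero k j i
    rw [prodErase₂_comm] at h₂
    have h₃ := hβ.node_sub_ne_zero hij k
    have h₃' := hβ.node_sub_ne_zero hji k
    have h₄ := hβ.node_sub_add_ne_zero hij k 1
    have h₅ := hβ.node_sub_add_ne_zero hji k (-1)
    push_cast at h₄ h₅
    field_simp
    ring

/-- The polynomial `Π_{j ≠ i} (X + β_j + k_j)`. -/
noncomputable def prodEraseP (β : Fin p → F) (k : Fin p → ℤ) (i : Fin p) : F[X] :=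
  ∏ j ∈ univ.erase i, (X + C (node β k j))

/-- The polynomial `Π_i (X + β_i + k_i)`. -/
noncomputable def prodAllP (β : Fin p → F) (k : Fin p → ℤ) : F[X] :=
  ∏ i, (X + C (node β k i))

@[simp]
theorem eval_prodEraseP (β : Fin p → F) (k : Fin p → ℤ) (i : Fin p) (u : F) :
    (prodEraseP β k i).eval u = prodErase β k i u := by
  simp [prodEraseP, prodErase, eval_prod]

@[simp]
theorem eval_prodAllP (β : Fin p → F) (k : Fin p → ℤ) (u : F) :
    (prodAllP β k).eval u = prodAll β k u := by
  simp [prodAllP, prodAll, eval_prod]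

theorem monic_prodAllP (β : Fin p → F) (k : Fin p → ℤ) : (prodAllP β k).Monic :=
  monic_prod_of_monic _ _ fun _ _ => monic_X_add_C _

theorem natDegree_prodAllP (β : Fin p → F) (k : Fin p → ℤ) : (prodAllP β k).natDegree = p := by
  rw [prodAllP, natDegree_prod_of_monic _ _ fun _ _ => monic_X_add_C _]
  simp

theorem natDegree_prodEraseP (β : Fin p → F) (k : Fin p → ℤ) (i : Fin p) :
    (prodEraseP β k i).natDegree = p - 1 := by
  rw [prodEraseP, natDegree_prod_of_monic _ _ fun _ _ => monic_X_add_C _]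
  simp

theorem prodErase_neg_node (β : Fin p → F) (k : Fin p → ℤ) {i j : Fin p} (h : j ≠ i) :
    prodErase β k i (-node β k j) = 0 :=
  prod_eq_zero (mem_erase.2 ⟨h, mem_univ j⟩) (neg_add_cancel _)

theorem prodAll_neg_node (β : Fin p → F) (k : Fin p → ℤ) (j : Fin p) :
    prodAll β k (-node β k j) = 0 :=
  prod_eq_zero (mem_univ j) (neg_add_cancel _)

/-- Two polynomial functions of the form below agree as soon as they agree at the `2p` points
`-β_i - k_i` and `1 - β_i - k_i`. -/
theorem interpolation {β : Fin p → F} (hβ : Generic β) (k : Fin p → ℤ) {γ : F[X]}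
    (hm : γ.Monic) (hd : γ.natDegree = 2 * p) (q r : Fin p → F)
    (h₁ : ∀ i, q i * prodErase β k i (-node β k i) * prodAll β k (-node β k i - 1) =
      γ.eval (-node β k i) +
        r i * (prodErase β k i (-node β k i) * prodErase β k i (-node β k i - 1)))
    (h₂ : ∀ i, γ.eval (1 - node β k i) +
      r i * (prodErase β k i (1 - node β k i) * prodErase β k i (-node β k i)) = 0) (u : F) :
    (prodAll β k u + ∑ i, q i * prodErase β k i u) * prodAll β k (u - 1) =
      γ.eval u + ∑ i, r i * (prodErase β k i u * prodErase β k i (u - 1)) := by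
  have hX : (X - 1 : F[X]).natDegree = 1 := natDegree_X_sub_C 1
  let P : F[X] := (prodAllP β k + ∑ i, C (q i) * prodEraseP β k i) * (prodAllP β k).comp (X - 1)
  let Q : F[X] := γ + ∑ i, C (r i) * (prodEraseP β k i * (prodEraseP β k i).comp (X - 1))
  have hdeg {n : ℕ} (hn : 0 < p → 0 < n) (f : Fin p → F[X])
      (hf : ∀ i, (f i).natDegree < n) : (∑ i, f i).degree < n := by
    refine (degree_sum_le _ _).trans_lt ?_
    rw [Finset.sup_lt_iff (by exact_mod_cast WithBot.bot_lt_coe n)]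
    exact fun i _ => (degree_le_natDegree).trans_lt (by exact_mod_cast hf i)
  have hP₁ : (∑ i, C (q i) * prodEraseP β k i).degree < (prodAllP β k).degree := by
    rw [degree_eq_natDegree (monic_prodAllP β k).ne_zero, natDegree_prodAllP]
    refine hdeg id _ fun i => (natDegree_C_mul_le _ _).trans_lt ?_
    rw [natDegree_prodEraseP]
    have := i.pos
    omega
  have hP₂ : (prodAllP β k + ∑ i, C (q i) * prodEraseP β k i).Monic :=
    (monic_prodAllP β k).add_of_left hP₁
  have hP₃ : ((prodAllP β k).comp (X - 1)).Monic :=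
    (monic_prodAllP β k).comp (monic_X_sub_C 1) (by rw [hX]; exact one_ne_zero)
  have hP : P.Monic := hP₂.mul hP₃
  have hPd : P.natDegree = 2 * p := by
    rw [hP₂.natDegree_mul hP₃, natDegree_comp, hX, natDegree_add_eq_left_of_degree_lt hP₁,
      natDegree_prodAllP]
    ring
  have hQ₁ : (∑ i, C (r i) * (prodEraseP β k i * (prodEraseP β k i).comp (X - 1))).degree <
      γ.degree := by
    rw [degree_eq_natDegree hm.ne_zero, hd]
    refine hdeg (by omega) _ fun i => (natDegree_C_mul_le _ _).trans_lt ?_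
    refine natDegree_mul_le.trans_lt ?_
    rw [natDegree_comp, hX, natDegree_prodEraseP]
    have := i.pos
    omega
  have hQ : Q.Monic := hm.add_of_left hQ₁
  have hQd : Q.natDegree = 2 * p := (natDegree_add_eq_left_of_degree_lt hQ₁).trans hd
  have hsub : (P - Q).degree < (2 * p : ℕ) := by
    have hPd' : P.degree = (2 * p : ℕ) := by rw [degree_eq_natDegree hP.ne_zero, hPd]
    have hQd' : Q.degree = (2 * p : ℕ) := by rw [degree_eq_natDegree hQ.ne_zero, hQd]
    rw [← hPd']
    exact degree_sub_lt_left (hPd'.trans hQd'.symm) hP.ne_zero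
      (hP.leadingCoeff.trans hQ.leadingCoeff.symm)
  have hinj : Function.Injective
      (Sum.elim (fun i => -node β k i) (fun i => 1 - node β k i) : Fin p ⊕ Fin p → F) := by
    have key {i j : Fin p} (s : ℤ) (e : node β k i - node β k j + s = 0) : i = j := by
      by_contra h
      exact hβ.node_sub_add_ne_zero h k s e
    have key' (i j : Fin p) : -node β k i ≠ 1 - node β k j := fun e => by
      obtain rfl := key (i := i) (j := j) 1 (by push_cast; linear_combination -e)
      exact one_ne_zero (α := F) (by linear_combination -e)
    rintro (i | i) (j | j) e <;> simp only [Sum.elim_inl, Sum.elim_inr] at e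
    · rw [key (i := i) (j := j) 0 (by push_cast; linear_combination -e)]
    · exact (key' i j e).elim
    · exact (key' j i e.symm).elim
    · rw [key (i := i) (j := j) 0 (by push_cast; linear_combination -e)]
  have hPe (u : F) : P.eval u =
      (prodAll β k u + ∑ i, q i * prodErase β k i u) * prodAll β k (u - 1) := by
    simp [P, eval_finsetSum]
  have hQe (u : F) : Q.eval u =
      γ.eval u + ∑ i, r i * (prodErase β k i u * prodErase β k i (u - 1)) := by
    simp [Q, eval_finsetSum]
  have hPQ : P = Q := by
    refine eq_of_degree_sub_lt_of_eval_index_eq univ hinj.injOn ?_ ?_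
    · convert hsub using 2
      simp [two_mul]
    · rintro (i | i) - <;> rw [hPe, hQe] <;> simp only [Sum.elim_inl, Sum.elim_inr]
      · rw [sum_eq_single i, sum_eq_single i, prodAll_neg_node, zero_add, h₁]
        · exact fun j _ hj => by rw [prodErase_neg_node β k hj.symm, zero_mul, mul_zero]
        · simp
        · exact fun j _ hj => by rw [prodErase_neg_node β k hj.symm, mul_zero]
        · simp
      · rw [show 1 - node β k i - 1 = -node β k i by ring, prodAll_neg_node, mul_zero,
          sum_eq_single i, h₂]
        · exact fun j _ hj => by rw [prodErase_neg_node β k hj.symm, mul_zero, mul_zero]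
        · simp
  rw [← hPe, hPQ, hQe]

theorem opA_opD {β : Fin p → F} (hβ : Generic β) {γ : F[X]} (hm : γ.Monic)
    (hd : γ.natDegree = 2 * p) {A B : Fin p → ℤ → F}
    (hAB : ∀ i n, A i n * B i (n + 1) = -γ.eval (-(β i + n))) (u : F) :
    opA β A B u * opD β (u - 1) = algebraMap F (Module.End F (UM F p)) (γ.eval u) +
      opS β A 1 u * opS β B (-1) (u - 1) := by
  rw [← sub_eq_zero]
  refine end_ext fun k => ?_
  simp only [LinearMap.sub_apply, LinearMap.add_apply, Module.End.mul_apply, opD_xi, opS_xi,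
    opA_xi, map_sum, map_smul, smul_add, smul_sum, smul_smul, Module.algebraMap_end_apply,
    LinearMap.zero_apply]
  rw [add_sub_add_comm, ← sub_smul, sum_comm (s := univ) (t := univ), ← sum_sub_distrib]
  have hdiag (i : Fin p) : k + Pi.single i 1 + Pi.single i (-1) = k := by
    rw [add_assoc, ← Pi.single_add]
    simp
  rw [sum_congr rfl (g := fun i => (prodAll β k (u - 1) * Ecoef β A B k i i u -
    B i (k i) * Lcoef F β (u - 1) i k * (A i (k i - 1) *
      Lcoef F β u i (k + Pi.single i (-1)))) • xi F p k), ← sum_smul, ← add_smul]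
  · convert zero_smul F _
    rw [sum_sub_distrib, ← mul_sum]
    have hD (i : Fin p) : prodErase β k i (-node β k i) ≠ 0 := by
      simpa using hβ.prodErase_ne_zero k i 0
    have hD₁ (i : Fin p) : prodErase β k i (-(node β k i + 1)) ≠ 0 := by
      simpa using hβ.prodErase_ne_zero k i 1
    have hD₂ (i : Fin p) : prodErase β k i (-(node β k i - 1)) ≠ 0 := by
      simpa [sub_eq_add_neg] using hβ.prodErase_ne_zero k i (-1)
    have := interpolation hβ k hm hd
      (fun i => (A i (k i) * B i (k i + 1) / prodErase β k i (-(node β k i + 1)) -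
        A i (k i - 1) * B i (k i) / prodErase β k i (-(node β k i - 1))) /
          prodErase β k i (-node β k i))
      (fun i => A i (k i - 1) * B i (k i) / (prodErase β k i (-node β k i) *
        prodErase β k i (-(node β k i - 1)))) (fun i => ?_) (fun i => ?_) u
    · simp only [Ecoef, if_true, Lcoef_eq β _ _ k, Lcoef_add_single_self, Int.cast_neg,
        Int.cast_one, ← sub_eq_add_neg]
      have hq (i : Fin p) (x : F) : prodErase β k i u / prodErase β k i (-node β k i) * x =
          x / prodErase β k i (-node β k i) * prodErase β k i u := by ring
      have hr (i : Fin p) : B i (k i) * (prodErase β k i (u - 1) / prodErase β k i (-node β k i)) *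
          (A i (k i - 1) * (prodErase β k i u / prodErase β k i (-(node β k i - 1)))) =
          A i (k i - 1) * B i (k i) / (prodErase β k i (-node β k i) *
            prodErase β k i (-(node β k i - 1))) *
              (prodErase β k i u * prodErase β k i (u - 1)) := by ring
      simp only [hq, hr]
      linear_combination this
    · have h₀ := hAB i (k i)
      rw [prodAll_eq β k i, show -node β k i - 1 = -(node β k i + 1) by ring]
      rw [← node] at h₀
      rw [← neg_eq_iff_eq_neg.2 h₀]
      have := hD i
      have := hD₁ i
      have := hD₂ i
      field_simp
      ring
    · have h₀ := hAB i (k i - 1)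
      rw [sub_add_cancel, Int.cast_sub, Int.cast_one, ← add_sub_assoc, ← node, neg_sub] at h₀
      rw [← neg_eq_iff_eq_neg.2 h₀, ← neg_sub (node β k i) 1]
      have := hD i
      have := hD₂ i
      field_simp
      ring
  · intro i _
    rw [← sum_sub_distrib, sum_eq_single i]
    · rw [add_right_comm k (Pi.single i (-1)), hdiag, ← sub_smul, Pi.add_apply, Pi.single_eq_same,
        ← sub_eq_add_neg]
    · intro j _ hji
      have hij := Ne.symm hji
      rw [add_right_comm k (Pi.single i (-1)), ← sub_smul]
      convert zero_smul F _
      simp only [Ecoef, if_neg hji, Pi.add_apply, Pi.single_eq_of_ne hji,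
        add_zero, Lcoef_eq_of_ne β _ hji k, Lcoef_add_single_of_ne β _ hij,
        prodErase₂_comm β k j i, prodAll_eq β k j,
        prodErase_eq β k hij, Int.cast_neg, Int.cast_one]
      have h₁ := hβ.prodErase₂_ne_zero k i j
      have h₂ := hβ.prodErase₂_ne_zero k j i
      rw [prodErase₂_comm] at h₂
      have h₃ := hβ.node_sub_ne_zero hji k
      have h₄ := hβ.node_sub_add_ne_zero hji k 1
      have h₅ := hβ.node_sub_add_ne_zero hij k (-1)
      have h₆ := hβ.node_sub_ne_zero hij k
      push_cast at h₄ h₅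
      field_simp
      ring
    · simp

/-- The generating functions as operators depending on a point of the field. -/
noncomputable def opT (β : Fin p → F) (A B : Fin p → ℤ → F) (i j : Fin 2) (u : F) :
    Module.End F (UM F p) :=
  !![opA β A B u, opS β B (-1) u; opS β A 1 u, opD β u] i j

theorem opT_one_one (β : Fin p → F) (A B : Fin p → ℤ → F) (u : F) :
    opT β A B 1 1 u = opD β u :=
  rfl

theorem opT_one_zero (β : Fin p → F) (A B : Fin p → ℤ → F) (u : F) :
    opT β A B 1 0 u = opS β A 1 u :=
  rfl

theorem opT_zero_one (β : Fin p → F) (A B : Fin p → ℤ → F) (u : F) :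
    opT β A B 0 1 u = opS β B (-1) u :=
  rfl

theorem gaussData_opT {β : Fin p → F} (hβ : Generic β) {γ : F[X]} (hm : γ.Monic)
    (hd : γ.natDegree = 2 * p) {A B : Fin p → ℤ → F}
    (hAB : ∀ i n, A i n * B i (n + 1) = -γ.eval (-(β i + n))) :
    GaussData (opT β A B) {u | ∀ k, prodAll β k u ≠ 0} (fun u => γ.eval u) where
  dd := opD_comm β
  cc := opS_comm hβ A 1
  bb := opS_comm hβ B (-1)
  dc u v := by simpa [opT] using opD_opS β A 1 u v
  dc' u v := by simpa [opT] using opD_opS' β A 1 u v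
  db u v := by
    have := opD_opS' β B (-1) u v
    refine this.trans ?_
    rw [Int.cast_neg, Int.cast_one]
    change _ = opS β B (-1) u * opD β v - opS β B (-1) v * opD β u
    module
  db' u v := by
    have := opD_opS β B (-1) u v
    refine this.trans ?_
    rw [Int.cast_neg, Int.cast_one]
    change _ = opD β v * opS β B (-1) u - opD β u * opS β B (-1) v
    module
  cb := opS_opS hβ A B
  qdet := opA_opD hβ hm hd hAB
  sub_one_mem u hu k := by
    convert hu (k - 1) using 1
    exact prod_congr rfl fun i _ => by simp [node]; ring
  cancel_left u hu x y h := by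
    refine end_ext fun k => Finsupp.ext fun l => ?_
    have hD (z : UM F p) : (opD β u z) l = prodAll β l u * z l := by
      induction z using Finsupp.induction_linear with
      | zero => simp
      | add f g hf hg => simp [hf, hg, mul_add]
      | single m c =>
        rw [opD, Finsupp.linearCombination_single]
        by_cases hml : m = l
        · subst hml
          simp [xi, mul_comm]
        · simp [xi, Finsupp.single_eq_of_ne' hml]
    have := DFunLike.congr_fun (LinearMap.congr_fun h (xi F p k)) l
    exact mul_left_cancel₀ (hu l) (by rwa [← hD, ← hD])
  cancel_right u hu x y h := end_ext fun k => by
    have := LinearMap.congr_fun h (xi F p k)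
    change x (opD β u _) = y (opD β u _) at this
    rw [opD_xi, map_smul, map_smul] at this
    exact smul_right_injective _ (hu k) this

end Operators

section Expansion

open Finset

variable {K F : Type} [Field K] [Field F] [Algebra K F] {p : ℕ}

/-- The coefficient of `u ^ n` of the operator whose matrix entries are the polynomials `e`. -/
noncomputable def coeffOp (e : (Fin p → ℤ) → (Fin p → ℤ) →₀ K[X]) (n : ℕ) :
    Module.End K (UM K p) :=
  Finsupp.linearCombination K fun k => Finsupp.mapRange.linearMap (lcoeff K n) (e k)

/-- The value at `x` of the operator whose matrix entries are the polynomials `e`. -/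
noncomputable def evalOp (e : (Fin p → ℤ) → (Fin p → ℤ) →₀ K[X]) (x : F) :
    Module.End F (UM F p) :=
  Finsupp.linearCombination F fun k =>
    Finsupp.mapRange.linearMap (aeval (R := K) x).toLinearMap (e k)

/-- Extension of scalars. -/
noncomputable def extend (K F : Type) [Field K] [Field F] [Algebra K F] (p : ℕ) :
    UM K p →ₗ[K] UM F p :=
  Finsupp.mapRange.linearMap (Algebra.linearMap K F)

@[simp]
theorem extend_apply (m : UM K p) (l : Fin p → ℤ) : extend K F p m l = algebraMap K F (m l) :=
  rfl

theorem evalOp_extend {e : (Fin p → ℤ) → (Fin p → ℤ) →₀ K[X]} {N : ℕ}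
    (he : ∀ k l, (e k l).natDegree < N) (x : F) (m : UM K p) :
    evalOp e x (extend K F p m) = ∑ n ∈ range N, x ^ n • extend K F p (coeffOp e n m) := by
  induction m using Finsupp.induction_linear with
  | zero => simp
  | add f g hf hg => simp only [map_add, smul_add, sum_add_distrib, hf, hg]
  | single k c =>
    refine Finsupp.ext fun l => ?_
    have : extend K F p (Finsupp.single k c) = Finsupp.single k (algebraMap K F c) := by
      simp [extend]
    rw [this, evalOp, Finsupp.linearCombination_single, Finsupp.finsetSum_apply]
    simp only [coeffOp, Finsupp.linearCombination_single, Finsupp.smul_apply, extend_apply,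
      Finsupp.mapRange.linearMap_apply, Finsupp.mapRange_apply, AlgHom.toLinearMap_apply,
      aeval_eq_sum_range' (he k l), smul_eq_mul, mul_sum, map_mul, lcoeff_apply, Algebra.smul_def]
    exact sum_congr rfl fun n _ => by ring

theorem evalOp_evalOp_extend {e e' : (Fin p → ℤ) → (Fin p → ℤ) →₀ K[X]} {N : ℕ}
    (he : ∀ k l, (e k l).natDegree < N) (he' : ∀ k l, (e' k l).natDegree < N) (x y : F)
    (m : UM K p) :
    (evalOp e x * evalOp e' y) (extend K F p m) = ∑ a ∈ range N, ∑ b ∈ range N,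
      (x ^ a * y ^ b) • extend K F p ((coeffOp e a * coeffOp e' b) m) := by
  rw [Module.End.mul_apply, evalOp_extend he', map_sum, sum_comm]
  refine sum_congr rfl fun b _ => ?_
  rw [map_smul, evalOp_extend he, smul_sum]
  exact sum_congr rfl fun a _ => by rw [smul_smul, mul_comm]; rfl

/-- Comparison of coefficients in `(X - Y) g(X, Y) = h(X, Y)`. -/
theorem coeff_relations [Algebra K[X][X] F] [IsScalarTower K K[X][X] F]
    (hinj : Function.Injective (algebraMap K[X][X] F)) {u v : F}
    (hu : u = algebraMap K[X][X] F (C X)) (hv : v = algebraMap K[X][X] F X) {N : ℕ}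
    {g h : ℕ → ℕ → K} (hg : ∀ a b, N ≤ a ∨ N ≤ b → g a b = 0)
    (hh : ∀ a b, N ≤ a ∨ N ≤ b → h a b = 0)
    (e : (u - v) * ∑ a ∈ range N, ∑ b ∈ range N, u ^ a * v ^ b * algebraMap K F (g a b) =
      ∑ a ∈ range N, ∑ b ∈ range N, u ^ a * v ^ b * algebraMap K F (h a b)) (a b : ℕ) :
    g a (b + 1) - g (a + 1) b = h (a + 1) (b + 1) ∧ g a 0 = h (a + 1) 0 := by
  let P (f : ℕ → ℕ → K) : K[X][X] :=
    ∑ a ∈ range N, ∑ b ∈ range N, monomial b (monomial a (f a b))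
  have hP (f : ℕ → ℕ → K) (hf : ∀ a b, N ≤ a ∨ N ≤ b → f a b = 0) (a b : ℕ) :
      ((P f).coeff b).coeff a = f a b := by
    simp only [P, finsetSum_coeff, coeff_monomial, apply_ite (fun q : K[X] => q.coeff a),
      coeff_zero, sum_ite_eq', mem_range]
    by_cases hb : b < N
    · by_cases ha : a < N
      · simp [ha, hb]
      · simp [ha, hf a b (Or.inl (not_lt.1 ha))]
    · simp [hb, hf a b (Or.inr (not_lt.1 hb))]
  have hPF (f : ℕ → ℕ → K) : algebraMap K[X][X] F (P f) =
      ∑ a ∈ range N, ∑ b ∈ range N, u ^ a * v ^ b * algebraMap K F (f a b) := by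
    simp only [P, map_sum, ← C_mul_X_pow_eq_monomial, map_mul, map_pow, ← hu, ← hv,
      IsScalarTower.algebraMap_apply K K[X][X] F]
    refine sum_congr rfl fun a _ => sum_congr rfl fun b _ => ?_
    rw [mul_assoc, mul_comm]
    ring_nf
    rfl
  have key : (C X - X) * P g = P h := hinj <| by
    rw [map_mul, map_sub, hPF, hPF, ← hu, ← hv, e]
  have h₁ := congrArg (fun f => (f.coeff (b + 1)).coeff (a + 1)) key
  have h₂ := congrArg (fun f => (f.coeff 0).coeff (a + 1)) key
  simp only [sub_mul, coeff_sub, coeff_C_mul, coeff_X_mul, hP g hg, hP h hh,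
    coeff_X_mul_zero, sub_zero] at h₁ h₂
  exact ⟨h₁, h₂⟩

end Expansion

section Entries

open Finset

variable {K F : Type} [Field K] [Field F] [Algebra K F] {p : ℕ}

/-- The polynomial whose values are given by `Lcoef`. -/
noncomputable def LcoefP (β : Fin p → K) (k : Fin p → ℤ) (i : Fin p) : K[X] :=
  C (prodErase β k i (-node β k i))⁻¹ * prodEraseP β k i

/-- The polynomial `Π_{l ≠ i, j} (X + β_l + k_l)`. -/
noncomputable def prodErase₂P (β : Fin p → K) (k : Fin p → ℤ) (i j : Fin p) : K[X] :=
  ∏ l ∈ (univ.erase i).erase j, (X + C (node β k l))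

/-- The polynomial whose values are given by `Ecoef`. -/
noncomputable def EcoefP (β : Fin p → K) (A B : Fin p → ℤ → K) (k : Fin p → ℤ) (i j : Fin p) :
    K[X] :=
  if i = j then
    LcoefP β k i *
      C (A i (k i) * B i (k i + 1) / prodErase β k i (-(node β k i + 1)) -
        A i (k i - 1) * B i (k i) / prodErase β k i (-(node β k i - 1)))
  else prodErase₂P β k i j * C (-(A i (k i) * B j (k j)) /
    (prodErase₂ β k i j (-node β k i) * prodErase₂ β k j i (-node β k j) *
      ((node β k i - node β k j) * (node β k i - node β k j + 1))))

/-- The matrix entries of `T_21(u)` and `T_12(u)` as polynomials in `u`. -/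
noncomputable def entryS (β : Fin p → K) (f : Fin p → ℤ → K) (s : ℤ) (k : Fin p → ℤ) :
    (Fin p → ℤ) →₀ K[X] :=
  ∑ i, Finsupp.single (k + Pi.single i s) (C (f i (k i)) * LcoefP β k i)

/-- The matrix entries of `T_22(u)` as polynomials in `u`. -/
noncomputable def entryD (β : Fin p → K) (k : Fin p → ℤ) : (Fin p → ℤ) →₀ K[X] :=
  Finsupp.single k (prodAllP β k)

/-- The matrix entries of `T_11(u) - T_22(u)` as polynomials in `u`. -/
noncomputable def entryE (β : Fin p → K) (A B : Fin p → ℤ → K) (k : Fin p → ℤ) :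
    (Fin p → ℤ) →₀ K[X] :=
  ∑ i, ∑ j, Finsupp.single (k + Pi.single i 1 + Pi.single j (-1)) (EcoefP β A B k i j)

/-- The matrix entries of the generating functions as polynomials in `u`. -/
noncomputable def entry (β : Fin p → K) (A B : Fin p → ℤ → K) (i j : Fin 2) (k : Fin p → ℤ) :
    (Fin p → ℤ) →₀ K[X] :=
  !![entryD β k + entryE β A B k, entryS β B (-1) k; entryS β A 1 k, entryD β k] i j

theorem natDegree_LcoefP_lt (β : Fin p → K) (k : Fin p → ℤ) (i : Fin p) :
    (LcoefP β k i).natDegree < p := by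
  refine (natDegree_C_mul_le _ _).trans_lt ?_
  rw [natDegree_prodEraseP]
  have := i.pos
  omega

theorem natDegree_EcoefP_lt (β : Fin p → K) (A B : Fin p → ℤ → K) (k : Fin p → ℤ)
    (i j : Fin p) : (EcoefP β A B k i j).natDegree < p := by
  unfold EcoefP
  split_ifs
  · exact (natDegree_mul_C_le _ _).trans_lt (natDegree_LcoefP_lt β k i)
  · refine (natDegree_mul_C_le _ _).trans_lt ?_
    rw [prodErase₂P, natDegree_prod_of_monic _ _ fun _ _ => monic_X_add_C _]
    simp only [natDegree_X_add_C, sum_const, smul_eq_mul, mul_one]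
    have h₁ := card_le_card (erase_subset j (univ.erase i))
    have h₂ : #(univ.erase i) = p - 1 := by simp
    have := i.pos
    omega

theorem single_mem_degreeLT {n : ℕ} (k l : Fin p → ℤ) {q : K[X]} (hq : q.natDegree < n) :
    Finsupp.single k q l ∈ degreeLT K n := by
  rw [Finsupp.single_apply]
  split_ifs
  · exact mem_degreeLT.2 (degree_le_natDegree.trans_lt (by exact_mod_cast hq))
  · exact zero_mem _

theorem entryS_mem_degreeLT (β : Fin p → K) (f : Fin p → ℤ → K) (s : ℤ) (k l : Fin p → ℤ) :
    entryS β f s k l ∈ degreeLT K p := by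
  rw [entryS, Finsupp.finsetSum_apply]
  exact sum_mem fun i _ => single_mem_degreeLT _ _
    ((natDegree_C_mul_le _ _).trans_lt (natDegree_LcoefP_lt β k i))

theorem entryE_mem_degreeLT (β : Fin p → K) (A B : Fin p → ℤ → K) (k l : Fin p → ℤ) :
    entryE β A B k l ∈ degreeLT K p := by
  simp only [entryE, Finsupp.finsetSum_apply]
  exact sum_mem fun i _ => sum_mem fun j _ => single_mem_degreeLT _ _
    (natDegree_EcoefP_lt β A B k i j)

theorem entryD_mem_degreeLT (β : Fin p → K) (k l : Fin p → ℤ) :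
    entryD β k l ∈ degreeLT K (p + 1) :=
  single_mem_degreeLT _ _ (by rw [natDegree_prodAllP]; exact p.lt_succ_self)

theorem natDegree_entry_lt (β : Fin p → K) (A B : Fin p → ℤ → K) (i j : Fin 2)
    (k l : Fin p → ℤ) : (entry β A B i j k l).natDegree < p + 1 := by
  have hle : degreeLT K p ≤ degreeLT K (p + 1) := degreeLT_mono p.le_succ
  have : entry β A B i j k l ∈ degreeLT K (p + 1) := by
    fin_cases i <;> fin_cases j
    · exact add_mem (entryD_mem_degreeLT β k l) (hle (entryE_mem_degreeLT β A B k l))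
    · exact hle (entryS_mem_degreeLT β B (-1) k l)
    · exact hle (entryS_mem_degreeLT β A 1 k l)
    · exact entryD_mem_degreeLT β k l
  rw [mem_degreeLT] at this
  by_cases h : entry β A B i j k l = 0
  · simp [h]
  · exact (natDegree_lt_iff_degree_lt h).2 this

theorem coeffOp_eq_zero {e : (Fin p → ℤ) → (Fin p → ℤ) →₀ K[X]} {n : ℕ}
    (he : ∀ k l, (e k l).coeff n = 0) : coeffOp e n = 0 :=
  end_ext fun k => Finsupp.ext fun l => by simp [coeffOp, xi, he]

theorem coeff_entryD_self (β : Fin p → K) (k l : Fin p → ℤ) :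
    (entryD β k l).coeff p = xi K p k l := by
  rw [entryD, xi, Finsupp.single_apply, Finsupp.single_apply]
  split_ifs
  · simpa [natDegree_prodAllP] using (monic_prodAllP β k).coeff_natDegree
  · rfl

theorem coeffOp_entry_self (β : Fin p → K) (A B : Fin p → ℤ → K) (i j : Fin 2) :
    coeffOp (entry β A B i j) p = if i = j then 1 else 0 := by
  have h₀ {q : K[X]} (hq : q ∈ degreeLT K p) : q.coeff p = 0 :=
    coeff_eq_zero_of_degree_lt (mem_degreeLT.1 hq)
  fin_cases i <;> fin_cases j
  · refine end_ext fun k => Finsupp.ext fun l => ?_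
    have : (entryD β k l + entryE β A B k l).coeff p = xi K p k l := by
      rw [coeff_add, coeff_entryD_self, h₀ (entryE_mem_degreeLT β A B k l), add_zero]
    simpa [coeffOp, xi, entry] using this
  · exact coeffOp_eq_zero fun k l => h₀ (entryS_mem_degreeLT β B (-1) k l)
  · exact coeffOp_eq_zero fun k l => h₀ (entryS_mem_degreeLT β A 1 k l)
  · refine end_ext fun k => Finsupp.ext fun l => ?_
    simpa [coeffOp, xi, entry] using coeff_entryD_self β k l

theorem coeffOp_entry_of_lt (β : Fin p → K) (A B : Fin p → ℤ → K) (i j : Fin 2) {n : ℕ}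
    (hn : p < n) : coeffOp (entry β A B i j) n = 0 :=
  coeffOp_eq_zero fun k l =>
    coeff_eq_zero_of_natDegree_lt ((natDegree_entry_lt β A B i j k l).trans_le hn)

theorem algebraMap_node (β : Fin p → K) (k : Fin p → ℤ) (i : Fin p) :
    algebraMap K F (node β k i) = node (fun i => algebraMap K F (β i)) k i := by
  simp [node]

theorem algebraMap_prodErase (β : Fin p → K) (k : Fin p → ℤ) (i : Fin p) (c : K) :
    algebraMap K F (prodErase β k i c) =
      prodErase (fun i => algebraMap K F (β i)) k i (algebraMap K F c) := by
  simp [prodErase, algebraMap_node]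

theorem aeval_prodAllP (β : Fin p → K) (k : Fin p → ℤ) (x : F) :
    aeval x (prodAllP β k) = prodAll (fun i => algebraMap K F (β i)) k x := by
  simp [prodAllP, prodAll, algebraMap_node]

theorem aeval_LcoefP (β : Fin p → K) (k : Fin p → ℤ) (i : Fin p) (x : F) :
    aeval x (LcoefP β k i) = Lcoef F (fun i => algebraMap K F (β i)) x i k := by
  rw [LcoefP, Lcoef_eq, map_mul, aeval_C, map_inv₀, algebraMap_prodErase, map_neg,
    algebraMap_node, div_eq_inv_mul]
  simp [prodEraseP, prodErase, algebraMap_node]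

theorem aeval_EcoefP (β : Fin p → K) (A B : Fin p → ℤ → K) (k : Fin p → ℤ) (i j : Fin p)
    (x : F) : aeval x (EcoefP β A B k i j) = Ecoef (fun i => algebraMap K F (β i))
      (fun i n => algebraMap K F (A i n)) (fun i n => algebraMap K F (B i n)) k i j x := by
  unfold EcoefP Ecoef
  split_ifs
  · simp [aeval_LcoefP, algebraMap_prodErase, algebraMap_node]
  · rw [mul_div_right_comm, mul_comm]
    simp [prodErase₂P, prodErase₂, algebraMap_node]

theorem evalOp_entry (β : Fin p → K) (A B : Fin p → ℤ → K) (i j : Fin 2) (x : F) :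
    evalOp (entry β A B i j) x = opT (fun i => algebraMap K F (β i))
      (fun i n => algebraMap K F (A i n)) (fun i n => algebraMap K F (B i n)) i j x := by
  refine end_ext fun k => ?_
  have hx (f : (Fin p → ℤ) → (Fin p → ℤ) →₀ K[X]) : evalOp f x (xi F p k) =
      Finsupp.mapRange.linearMap (aeval (R := K) x).toLinearMap (f k) := by
    simp [evalOp, xi]
  have hD : Finsupp.mapRange.linearMap (aeval (R := K) x).toLinearMap (entryD β k) =
      opD (fun i => algebraMap K F (β i)) x (xi F p k) := by
    rw [opD_xi]
    simp [entryD, aeval_prodAllP, xi]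
  have hS (f : Fin p → ℤ → K) (s : ℤ) :
      Finsupp.mapRange.linearMap (aeval (R := K) x).toLinearMap (entryS β f s k) =
        opS (fun i => algebraMap K F (β i)) (fun i n => algebraMap K F (f i n)) s x
          (xi F p k) := by
    rw [opS_xi]
    simp [entryS, aeval_LcoefP, xi, -Finsupp.single_mul]
  rw [hx]
  fin_cases i <;> fin_cases j
  · refine (map_add _ _ _).trans ?_
    rw [hD, opD_xi]
    refine Eq.trans ?_ (opA_xi _ _ _ x k).symm
    simp [entryE, aeval_EcoefP, xi]
  · exact hS B (-1)
  · exact hS A 1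
  · exact hD

end Entries

section Relations

open Finset

variable {K : Type} [Field K] {p : ℕ}

/-- The coefficient of `u ^ n` of the generating function `T_ij(u)`. -/
noncomputable def coeffT (β : Fin p → K) (A B : Fin p → ℤ → K) (i j : Fin 2) (n : ℕ) :
    Module.End K (UM K p) :=
  coeffOp (entry β A B i j) n

theorem coeffT_self (β : Fin p → K) (A B : Fin p → ℤ → K) (i j : Fin 2) :
    coeffT β A B i j p = if i = j then 1 else 0 :=
  coeffOp_entry_self β A B i j

theorem coeffT_of_lt (β : Fin p → K) (A B : Fin p → ℤ → K) (i j : Fin 2) {n : ℕ}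
    (hn : p < n) : coeffT β A B i j n = 0 :=
  coeffOp_entry_of_lt β A B i j hn

theorem rtt_extend {F : Type} [Field F] [Algebra K F] {β : Fin p → K} (hβ : Generic β) {γ : K[X]}
    (hm : γ.Monic) (hd : γ.natDegree = 2 * p) {A B : Fin p → ℤ → K}
    (hAB : ∀ i n, A i n * B i (n + 1) = -γ.eval (-(β i + n))) {u v : F}
    (hu : ∀ c : K, u + algebraMap K F c ≠ 0) (hv : ∀ c : K, v + algebraMap K F c ≠ 0)
    (huv : u ≠ v) (huv' : u - v + 1 ≠ 0) (i j k l : Fin 2) :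
    RTT (fun i j => evalOp (entry β A B i j)) i j k l u v := by
  have hβ' : Generic fun i => algebraMap K F (β i) := fun i j hij m e =>
    hβ i j hij m ((algebraMap K F).injective (by simpa using e))
  have hmem {x : F} (hx : ∀ c : K, x + algebraMap K F c ≠ 0) :
      x ∈ {u | ∀ k, prodAll (fun i => algebraMap K F (β i)) k u ≠ 0} := fun k =>
    prod_ne_zero_iff.2 fun i _ => by rw [← algebraMap_node]; exact hx _
  have := (gaussData_opT hβ' (hm.map (algebraMap K F)) ((γ.natDegree_map _).trans hd)
    (A := fun i n => algebraMap K F (A i n)) (B := fun i n => algebraMap K F (B i n))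
    (fun i n => by
      rw [← map_mul, hAB, map_neg, ← eval_map_apply]
      simp)).rtt (hmem hu) (hmem hv) huv huv' i j k l
  simpa only [RTT, evalOp_entry] using this

theorem sum_range_eq_coeff {F : Type} [Field F] [Algebra K F] (β : Fin p → K)
    (A B : Fin p → ℤ → K) (i j k l : Fin 2) (u v : F) (x : UM K p) (m : Fin p → ℤ) :
    (evalOp (entry β A B i j) u * evalOp (entry β A B k l) v) (extend K F p x) m =
      ∑ a ∈ range (p + 1), ∑ b ∈ range (p + 1), u ^ a * v ^ b *
        algebraMap K F ((coeffT β A B i j a * coeffT β A B k l b) x m) := by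
  rw [evalOp_evalOp_extend (natDegree_entry_lt β A B i j) (natDegree_entry_lt β A B k l)]
  simp only [Finsupp.finsetSum_apply]
  rfl

theorem sum_range_eq_coeff' {F : Type} [Field F] [Algebra K F] (β : Fin p → K)
    (A B : Fin p → ℤ → K) (i j k l : Fin 2) (u v : F) (x : UM K p) (m : Fin p → ℤ) :
    (evalOp (entry β A B i j) v * evalOp (entry β A B k l) u) (extend K F p x) m =
      ∑ a ∈ range (p + 1), ∑ b ∈ range (p + 1), u ^ a * v ^ b *
        algebraMap K F ((coeffT β A B i j b * coeffT β A B k l a) x m) := by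
  rw [sum_range_eq_coeff, sum_comm]
  exact sum_congr rfl fun a _ => sum_congr rfl fun b _ => by rw [mul_comm (u ^ a)]

theorem coeffT_relations {β : Fin p → K} (hβ : Generic β) {γ : K[X]}
    (hm : γ.Monic) (hd : γ.natDegree = 2 * p) {A B : Fin p → ℤ → K}
    (hAB : ∀ i n, A i n * B i (n + 1) = -γ.eval (-(β i + n))) (i j k l : Fin 2) (a b : ℕ) :
    (coeffT β A B i j a * coeffT β A B k l (b + 1) -
      coeffT β A B k l (b + 1) * coeffT β A B i j a) -
      (coeffT β A B i j (a + 1) * coeffT β A B k l b -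
        coeffT β A B k l b * coeffT β A B i j (a + 1)) =
      coeffT β A B k j (a + 1) * coeffT β A B i l (b + 1) -
        coeffT β A B k j (b + 1) * coeffT β A B i l (a + 1) ∧
    coeffT β A B i j a * coeffT β A B k l 0 - coeffT β A B k l 0 * coeffT β A B i j a =
      coeffT β A B k j (a + 1) * coeffT β A B i l 0 -
        coeffT β A B k j 0 * coeffT β A B i l (a + 1) := by
  let F := FractionRing K[X][X]
  let u := algebraMap K[X][X] F (C X)
  let v := algebraMap K[X][X] F X
  have hinj : Function.Injective (algebraMap K[X][X] F) := IsFractionRing.injective _ _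
  have hK (c : K) : algebraMap K F c = algebraMap K[X][X] F (C (C c)) :=
    IsScalarTower.algebraMap_apply K K[X][X] F c
  have hu (c : K) : u + algebraMap K F c ≠ 0 := by
    rw [hK, ← map_add, ← C_add, Ne, map_eq_zero_iff _ hinj, C_eq_zero]
    exact X_add_C_ne_zero c
  have hv (c : K) : v + algebraMap K F c ≠ 0 := by
    rw [hK, ← map_add, Ne, map_eq_zero_iff _ hinj]
    exact X_add_C_ne_zero _
  have huv : u ≠ v := fun e => by
    have := congrArg (fun f => f.coeff 1) (hinj e)
    simp at this
  have huv' : u - v + 1 ≠ 0 := fun e => by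
    rw [← map_sub, ← map_one (algebraMap K[X][X] F), ← map_add, map_eq_zero_iff _ hinj] at e
    have := congrArg (fun f => f.coeff 1) e
    simp [coeff_one] at this
  have hrtt := rtt_extend hβ hm hd hAB hu hv huv huv' i j k l
  have hzero (i j : Fin 2) {n : ℕ} (hn : p + 1 ≤ n) : coeffT β A B i j n = 0 :=
    coeffT_of_lt β A B i j hn
  have key (x : UM K p) (m : Fin p → ℤ) := coeff_relations hinj (u := u) (v := v) rfl rfl
    (N := p + 1)
    (g := fun a b => (coeffT β A B i j a * coeffT β A B k l b -
      coeffT β A B k l b * coeffT β A B i j a) x m)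
    (h := fun a b => (coeffT β A B k j a * coeffT β A B i l b -
        coeffT β A B k j b * coeffT β A B i l a) x m)
    (by rintro a b (h | h) <;> simp [hzero _ _ h]) (by rintro a b (h | h) <;> simp [hzero _ _ h])
    (by
      have := DFunLike.congr_fun (LinearMap.congr_fun hrtt (extend K F p x)) m
      simp only [LinearMap.smul_apply, LinearMap.sub_apply, Finsupp.smul_apply,
        Finsupp.sub_apply, sum_range_eq_coeff β A B i j k l u v,
        sum_range_eq_coeff' β A B k l i j u v, sum_range_eq_coeff β A B k j i l u v,
        sum_range_eq_coeff' β A B k j i l u v, smul_eq_mul] at this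
      simpa only [LinearMap.sub_apply, Finsupp.sub_apply, map_sub, mul_sub,
        sum_sub_distrib] using this) a b
  exact ⟨LinearMap.ext fun x => Finsupp.ext fun m => (key x m).1,
    LinearMap.ext fun x => Finsupp.ext fun m => (key x m).2⟩

end Relations

section Representation

open Finset

/-- The defining relations of the Yangian follow from the recursive form of the RTT
relation. -/
theorem commutator_eq_sum {R : Type*} [Ring R] (t : Fin 2 → Fin 2 → ℕ → R) {p : ℕ}
    (h₀ : ∀ i j k l s, t i j 0 * t k l s - t k l s * t i j 0 = 0)
    (hstep : ∀ i j k l r s, r < p →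
      (t i j (r + 1) * t k l s - t k l s * t i j (r + 1)) -
        (t i j r * t k l (s + 1) - t k l (s + 1) * t i j r) =
      t k j r * t i l s - t k j s * t i l r)
    (i j k l : Fin 2) {r : ℕ} (hr : r ≤ p) (s : ℕ) :
    t i j r * t k l s - t k l s * t i j r =
      ∑ a ∈ Icc 1 (min r s),
        (t k j (a - 1) * t i l (r + s - a) - t k j (r + s - a) * t i l (a - 1)) := by
  have hsum (r s : ℕ) (hr : r ≤ p) : t i j r * t k l s - t k l s * t i j r =
      ∑ a ∈ Icc 1 r,
        (t k j (a - 1) * t i l (r + s - a) - t k j (r + s - a) * t i l (a - 1)) := by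
    induction r generalizing s with
    | zero => simp [h₀]
    | succ r ih =>
      rw [sum_Icc_succ_top (by omega), ← sub_eq_iff_eq_add', add_tsub_cancel_right,
        add_tsub_cancel_left, ← hstep i j k l r s hr, ih (s + 1) (by omega)]
      simp only [add_right_comm r 1 s, add_assoc r s 1]
  rw [hsum r s hr]
  rw [← sum_sdiff (Icc_subset_Icc_right (min_le_left r s)), add_eq_right]
  refine sum_involution (fun a _ => r + s + 1 - a) (fun a ha => ?_) (fun a ha hne e => hne ?_)
    (fun a ha => ?_) (fun a ha => ?_) <;> simp only [mem_sdiff, mem_Icc] at ha ⊢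
  · rw [show r + s + 1 - a - 1 = r + s - a by omega,
      show r + s - (r + s + 1 - a) = a - 1 by omega, sub_add_sub_cancel, sub_self]
  · rw [show r + s - a = a - 1 by omega, sub_self]
  · omega
  · omega

variable {K : Type} [Field K] {p : ℕ}

/-- The operator by which `t_ij^(r)` acts. -/
noncomputable def genOp (β : Fin p → K) (A B : Fin p → ℤ → K) (i j : Fin 2) (r : ℕ) :
    Module.End K (UM K p) :=
  if r ≤ p then coeffT β A B i j (p - r) else 0

theorem genOp_of_lt (β : Fin p → K) (A B : Fin p → ℤ → K) (i j : Fin 2) {r : ℕ} (hr : p < r) :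
    genOp β A B i j r = 0 :=
  if_neg (not_le.2 hr)

theorem genOp_of_le (β : Fin p → K) (A B : Fin p → ℤ → K) (i j : Fin 2) {r : ℕ} (hr : r ≤ p) :
    genOp β A B i j r = coeffT β A B i j (p - r) :=
  if_pos hr

theorem genOp_zero (β : Fin p → K) (A B : Fin p → ℤ → K) (i j : Fin 2) :
    genOp β A B i j 0 = if i = j then 1 else 0 := by
  rw [genOp_of_le β A B i j p.zero_le, Nat.sub_zero, coeffT_self]

theorem genOp_commutator {β : Fin p → K} (hβ : Generic β) {γ : K[X]}
    (hm : γ.Monic) (hd : γ.natDegree = 2 * p) {A B : Fin p → ℤ → K}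
    (hAB : ∀ i n, A i n * B i (n + 1) = -γ.eval (-(β i + n))) (i j k l : Fin 2) {r : ℕ}
    (hr : r ≤ p) (s : ℕ) :
    genOp β A B i j r * genOp β A B k l s - genOp β A B k l s * genOp β A B i j r =
      ∑ a ∈ Icc 1 (min r s),
        (genOp β A B k j (a - 1) * genOp β A B i l (r + s - a) -
          genOp β A B k j (r + s - a) * genOp β A B i l (a - 1)) := by
  refine commutator_eq_sum (genOp β A B) (fun i j k l s => ?_) (fun i j k l r s hr => ?_)
    i j k l hr s
  · rw [genOp_zero]
    split_ifs <;> simp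
  · obtain hs | rfl | hs := lt_trichotomy s p
    · have := (coeffT_relations hβ hm hd hAB i j k l (p - (r + 1)) (p - (s + 1))).1
      rw [show p - (r + 1) + 1 = p - r by omega, show p - (s + 1) + 1 = p - s by omega] at this
      simpa only [genOp_of_le _ _ _ _ _ hr.le, genOp_of_le _ _ _ _ _ (Nat.succ_le_of_lt hr),
        genOp_of_le _ _ _ _ _ hs.le, genOp_of_le _ _ _ _ _ (Nat.succ_le_of_lt hs)] using this
    · have := (coeffT_relations hβ hm hd hAB i j k l (s - (r + 1)) 0).2
      rw [show s - (r + 1) + 1 = s - r by omega] at this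
      rw [genOp_of_lt _ _ _ _ _ (lt_add_one s), mul_zero, zero_mul, sub_self,
        genOp_of_le _ _ _ _ _ hr.le, genOp_of_le _ _ _ _ _ hr.le, genOp_of_le _ _ _ _ _ hr,
        genOp_of_le _ _ _ _ _ le_rfl, genOp_of_le _ _ _ _ _ le_rfl,
        genOp_of_le _ _ _ _ _ le_rfl, Nat.sub_self]
      exact (sub_zero _).trans this
    · simp [genOp_of_lt _ _ _ _ _ hs, genOp_of_lt _ _ _ _ _ (hs.trans s.lt_succ_self)]

theorem lift_tF (β : Fin p → K) (A B : Fin p → ℤ → K) (i j : Fin 2) (r : ℕ) :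
    FreeAlgebra.lift K (fun g : YGen p => genOp β A B g.1 g.2.1 (g.2.2 + 1)) (tF K p i j r) =
      genOp β A B i j r := by
  unfold tF
  split_ifs with h₀ hij hr
  · rw [h₀, genOp_zero, if_pos hij, map_one]
  · rw [h₀, genOp_zero, if_neg hij, map_zero]
  · rw [FreeAlgebra.lift_ι_apply]
    exact congrArg (genOp β A B i j) (by simp only; omega)
  · rw [map_zero, genOp_of_lt _ _ _ _ _ (not_le.1 hr)]

theorem exists_representation {β : Fin p → K} (hβ : Generic β) {γ : K[X]}
    (hm : γ.Monic) (hd : γ.natDegree = 2 * p) {A B : Fin p → ℤ → K}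
    (hAB : ∀ i n, A i n * B i (n + 1) = -γ.eval (-(β i + n))) :
    ∃ ρ : Yp K p →ₐ[K] Module.End K (UM K p), ∀ i j r, ρ (tY K p i j r) = genOp β A B i j r := by
  refine ⟨RingQuot.liftAlgHom K
    ⟨FreeAlgebra.lift K fun g : YGen p => genOp β A B g.1 g.2.1 (g.2.2 + 1), ?_⟩,
    fun i j r => ?_⟩
  · rintro _ _ ⟨i, j, k, l, r, s, -, hr, -, -⟩
    simpa only [map_sub, map_mul, map_sum, lift_tF] using
      genOp_commutator hβ hm hd hAB i j k l hr s
  · rw [tY, RingQuot.liftAlgHom_mkAlgHom_apply, lift_tF]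

theorem eval_map_TY {β : Fin p → K} {A B : Fin p → ℤ → K}
    {ρ : Yp K p →ₐ[K] Module.End K (UM K p)}
    (hρ : ∀ i j r, ρ (tY K p i j r) = genOp β A B i j r) (i j : Fin 2) (c : K) :
    ((TY K p i j).map ρ.toRingHom).eval (algebraMap K (Module.End K (UM K p)) c) =
      opT β A B i j c := by
  have h₁ : opT β A B i j c = ∑ n ∈ range (p + 1), c ^ n • coeffT β A B i j n := by
    refine LinearMap.ext fun x => ?_
    have := evalOp_extend (natDegree_entry_lt β A B i j) c x
    have hid (y : UM K p) : extend K K p y = y := Finsupp.ext fun _ => rfl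
    simp only [hid] at this
    rw [evalOp_entry] at this
    simpa [coeffT] using this
  have h₂ (x : Yp K p) : ρ.toRingHom x = ρ x := rfl
  rw [h₁, sum_range_succ, coeffT_self, add_comm, TY, Polynomial.map_add, eval_add,
    Polynomial.map_sum, eval_finsetSum]
  congr 1
  · split_ifs
    · rw [Polynomial.map_pow, map_X, eval_X_pow, ← map_pow, Algebra.algebraMap_eq_smul_one]
    · simp
  · refine sum_nbij' (p - ·) (p - ·) ?_ ?_ ?_ ?_ ?_
    · simp; omega
    · simp; omega
    · simp; omega
    · simp; omega
    · intro r hr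
      rw [Polynomial.map_mul, Polynomial.map_pow, map_X, map_C, eval_mul_X_pow, eval_C, h₂, hρ,
        genOp_of_le β A B i j (mem_Icc.1 hr).2, ← map_pow, ← Algebra.commutes,
        ← Algebra.smul_def]

theorem eval_comp_X_sub_one {R : Type*} [Ring R] [Algebra K R] (q : R[X]) (c : K) :
    (q.comp (X - 1)).eval (algebraMap K R c) = q.eval (algebraMap K R (c - 1)) := by
  induction q using Polynomial.induction_on' with
  | add f g hf hg => rw [add_comp, eval_add, eval_add, hf, hg]
  | monomial n a =>
    have : ((X - 1 : R[X]) ^ n) = ((X - 1 : K[X]) ^ n).map (algebraMap K R) := by simp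
    rw [monomial_comp, eval_C_mul, eval_monomial, this, eval_map_algebraMap,
      aeval_algebraMap_apply_eq_algebraMap_eval]
    simp

theorem eval_mul_algebraMap {R : Type*} [Ring R] [Algebra K R] (f g : R[X]) (c : K) :
    (f * g).eval (algebraMap K R c) = f.eval (algebraMap K R c) * g.eval (algebraMap K R c) :=
  eval₂_mul_noncomm _ _ fun _ => Algebra.commute_algebraMap_right _ _

theorem eval_map_DY_eq {R : Type*} [Ring R] [Algebra K R] (f : Yp K p →+* R) (c : K) :
    ((DY K p).map f).eval (algebraMap K R c) =
      ((TY K p 0 0).map f).eval (algebraMap K R c) *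
          ((TY K p 1 1).map f).eval (algebraMap K R (c - 1)) -
        ((TY K p 1 0).map f).eval (algebraMap K R c) *
          ((TY K p 0 1).map f).eval (algebraMap K R (c - 1)) := by
  have hX : (X - 1 : (Yp K p)[X]).map f = X - 1 := by
    rw [Polynomial.map_sub, map_X, Polynomial.map_one]
  rw [DY, Polynomial.map_sub, eval_sub, Polynomial.map_mul, Polynomial.map_mul, map_comp,
    map_comp, hX, eval_mul_algebraMap, eval_mul_algebraMap, eval_comp_X_sub_one,
    eval_comp_X_sub_one]

theorem eval_map_DY {β : Fin p → K} (hβ : Generic β) {γ : K[X]}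
    (hm : γ.Monic) (hd : γ.natDegree = 2 * p) {A B : Fin p → ℤ → K}
    (hAB : ∀ i n, A i n * B i (n + 1) = -γ.eval (-(β i + n)))
    {ρ : Yp K p →ₐ[K] Module.End K (UM K p)}
    (hρ : ∀ i j r, ρ (tY K p i j r) = genOp β A B i j r) (c : K) :
    ((DY K p).map ρ.toRingHom).eval (algebraMap K (Module.End K (UM K p)) c) =
      algebraMap K (Module.End K (UM K p)) (γ.eval c) := by
  refine (eval_map_DY_eq (R := Module.End K (UM K p)) ρ.toRingHom c).trans (sub_eq_of_eq_add ?_)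
  have := opA_opD hβ hm hd hAB c
  have h (i j : Fin 2) (c : K) := eval_map_TY hρ i j c
  exact (congrArg₂ (· * ·) (h 0 0 c) (h 1 1 (c - 1))).trans (this.trans
    (congrArg (_ + ·) (congrArg₂ (· * ·) (h 1 0 c) (h 0 1 (c - 1))).symm))

theorem update_add_eq (k : Fin p → ℤ) (i : Fin p) (s : ℤ) :
    Function.update k i (k i + s) = k + Pi.single i s := by
  ext j
  by_cases h : j = i
  · subst h; simp
  · simp [h]

end Representation

end YangianModule

/-- The formulas for the action of `T_22(u)`, `T_21(u)`, `T_12(u)` on the basis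
`ξ^(k)`, together with the quantum-determinant formula determining `T_11(u)`, define a
representation of `Y_p(gl_2)` on the vector space with basis `ξ^(k)`, `k ∈ ℤ^p`. -/
theorem universal_module_exists (K : Type) [Field K] (p : ℕ)
    (β : Fin p → K) (hβ : ∀ i j, i ≠ j → ∀ m : ℤ, β i - β j ≠ (m : K))
    (γ : Polynomial K) (hmonic : γ.Monic) (hdeg : γ.natDegree = 2 * p) :
    ∃ ρ : Yp K p →ₐ[K] Module.End K (UM K p),
      (∀ (c : K) (k : Fin p → ℤ),
        (((TY K p 1 1).map ρ.toRingHom).eval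
            (algebraMap K (Module.End K (UM K p)) c)) (xi K p k) =
          (∏ i, (c + β i + (k i : K))) • xi K p k) ∧
      (∀ (c : K) (k : Fin p → ℤ),
        (((TY K p 1 0).map ρ.toRingHom).eval
            (algebraMap K (Module.End K (UM K p)) c)) (xi K p k) =
          ∑ i, (Acoef K γ β i k * Lcoef K β c i k) •
            xi K p (Function.update k i (k i + 1))) ∧
      (∀ (c : K) (k : Fin p → ℤ),
        (((TY K p 0 1).map ρ.toRingHom).eval
            (algebraMap K (Module.End K (UM K p)) c)) (xi K p k) =
          ∑ i, (Bcoef K γ β i k * Lcoef K β c i k) •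
            xi K p (Function.update k i (k i - 1))) ∧
      (∀ (c : K) (k : Fin p → ℤ),
        (((DY K p).map ρ.toRingHom).eval
            (algebraMap K (Module.End K (UM K p)) c)) (xi K p k) =
          γ.eval c • xi K p k) := by
  have hAB (i : Fin p) (n : ℤ) : (if 0 ≤ n then 1 else -γ.eval (-β i - (n : K))) *
      (if 0 < n + 1 then -γ.eval (-β i - ((n + 1 : ℤ) : K) + 1) else 1) =
        -γ.eval (-(β i + n)) := by
    by_cases hn : 0 ≤ n
    · rw [if_pos hn, if_pos (by omega), one_mul]
      congr 2
      push_cast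
      ring
    · rw [if_neg hn, if_neg (by omega), mul_one, neg_add']
  obtain ⟨ρ, hρ⟩ := YangianModule.exists_representation hβ hmonic hdeg
    (A := fun i n => if 0 ≤ n then 1 else -γ.eval (-β i - (n : K)))
    (B := fun i n => if 0 < n then -γ.eval (-β i - (n : K) + 1) else 1) hAB
  refine ⟨ρ, fun c k => ?_, fun c k => ?_, fun c k => ?_, fun c k => ?_⟩
  · rw [YangianModule.eval_map_TY hρ, YangianModule.opT_one_one, YangianModule.opD_xi]
    simp only [YangianModule.prodAll, YangianModule.node, add_assoc]
  · rw [YangianModule.eval_map_TY hρ, YangianModule.opT_one_zero, YangianModule.opS_xi]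
    simp only [YangianModule.update_add_eq, Acoef]
  · rw [YangianModule.eval_map_TY hρ, YangianModule.opT_zero_one, YangianModule.opS_xi]
    simp only [sub_eq_add_neg (k _) 1, YangianModule.update_add_eq, Bcoef]
  · rw [YangianModule.eval_map_DY hβ hmonic hdeg hAB hρ, Module.algebraMap_end_apply]
end

section
/- Consider the quiver A with vertices 1, 2, ..., r+1, arrows a_i: i → i+1 and b_i: i+1 → i for 1 ≤ i ≤ r, and relations a_i b_i = 0 and b_i a_i = 0. Then the indecomposable finite-dimensional representations of A are, up to isomorphism, exactly: the simple modules S_i (1 ≤ i ≤ r+1, one-dimensional at vertex i, zero elsewhere), and the modules M(k_1, k_2, ξ) for 1 ≤ k_1 < k_2 ≤ r+1 and functions ξ: {k_1, ..., k_2 - 1} → {0,1}, where M(k_1,k_2,ξ) has a one-dimensional space k·e_i at each vertex k_1 ≤ i ≤ k_2 and, for each i with k_1 ≤ i < k_2: if ξ(i) = 1 then a_i e_i = e_{i+1}, b_i e_{i+1} = 0; if ξ(i) = 0 then a_i e_i = 0, b_i e_{i+1} = e_i. In particular these modules are pairwise non-isomorphic and every indecomposable representation is isomorphic to one of them. -/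
/-- A finite-dimensional representation of the quiver `A` with vertices `0,…,r`,
arrows `a_i : i → i+1`, `b_i : i+1 → i`, and relations `a_i b_i = 0`, `b_i a_i = 0`. -/
structure ARep (K : Type) [Field K] (r : ℕ) where
  V : Fin (r + 1) → Type
  [addGrp : ∀ i, AddCommGroup (V i)]
  [mod : ∀ i, Module K (V i)]
  [fd : ∀ i, FiniteDimensional K (V i)]
  a : ∀ i : Fin r, V i.castSucc →ₗ[K] V i.succ
  b : ∀ i : Fin r, V i.succ →ₗ[K] V i.castSucc
  hab : ∀ i, (a i).comp (b i) = 0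
  hba : ∀ i, (b i).comp (a i) = 0

attribute [instance] ARep.addGrp ARep.mod ARep.fd

namespace ARep

variable {K : Type} [Field K] {r : ℕ}

/-- Isomorphism of representations of the quiver `A`. -/
def Iso (M N : ARep K r) : Prop :=
  ∃ f : ∀ i, M.V i ≃ₗ[K] N.V i,
    (∀ (i : Fin r) (x : M.V i.castSucc), f i.succ (M.a i x) = N.a i (f i.castSucc x)) ∧
    (∀ (i : Fin r) (x : M.V i.succ), f i.castSucc (M.b i x) = N.b i (f i.succ x))

/-- A family of subspaces is a subrepresentation if it is invariant under all the
arrows. -/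
def IsSubrep (M : ARep K r) (W : ∀ i, Submodule K (M.V i)) : Prop :=
  (∀ (i : Fin r), ∀ x ∈ W i.castSucc, M.a i x ∈ W i.succ) ∧
  (∀ (i : Fin r), ∀ x ∈ W i.succ, M.b i x ∈ W i.castSucc)

/-- A representation is indecomposable if it is nonzero and is not the direct sum of
two nonzero subrepresentations. -/
def Indec (M : ARep K r) : Prop :=
  (∃ i, Nontrivial (M.V i)) ∧
  ∀ W W' : ∀ i, Submodule K (M.V i), M.IsSubrep W → M.IsSubrep W' →
    (∀ i, IsCompl (W i) (W' i)) → (∀ i, W i = ⊥) ∨ (∀ i, W' i = ⊥)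

end ARep

/-- The linear map `K^d → K^e` all of whose matrix entries are `c`. -/
noncomputable def cmat (K : Type) [Field K] {d e : ℕ} (c : K) :
    (Fin d → K) →ₗ[K] (Fin e → K) :=
  Matrix.toLin' (Matrix.of fun _ _ => c)

lemma cmat_comp_eq_zero (K : Type) [Field K] {d e f : ℕ} (c c' : K) (h : c * c' = 0) :
    (cmat K (d := e) (e := f) c).comp (cmat K (d := d) (e := e) c') = 0 := by
  unfold cmat
  rw [← Matrix.toLin'_mul]
  have : (Matrix.of fun _ _ => c : Matrix (Fin f) (Fin e) K) *
      (Matrix.of fun _ _ => c' : Matrix (Fin e) (Fin d) K) = 0 := by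
    ext i j
    simp [Matrix.mul_apply, h]
  rw [this]
  exact LinearMap.ext fun v => by simp

/-- The simple representation `S_j`: one-dimensional at vertex `j`, zero elsewhere. -/
noncomputable def Srep (K : Type) [Field K] (r : ℕ) (j : Fin (r + 1)) : ARep K r where
  V i := Fin (if i = j then 1 else 0) → K
  a _ := 0
  b _ := 0
  hab _ := LinearMap.comp_zero _
  hba _ := LinearMap.comp_zero _

/-- The indecomposable representation `M(k₁, k₂, ξ)`: one-dimensional at the vertices
`k₁ ≤ i ≤ k₂` and zero elsewhere, with `a_i e_i = e_(i+1)`, `b_i e_(i+1) = 0` when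
`ξ i = 1` and `a_i e_i = 0`, `b_i e_(i+1) = e_i` when `ξ i = 0`. -/
noncomputable def Mrep (K : Type) [Field K] (r : ℕ) (k₁ k₂ : Fin (r + 1)) (ξ : ℕ → Bool) :
    ARep K r where
  V i := Fin (if k₁ ≤ i ∧ i ≤ k₂ then 1 else 0) → K
  a i := cmat K (if ξ (i : ℕ) then 1 else 0)
  b i := cmat K (if ξ (i : ℕ) then 0 else 1)
  hab i := cmat_comp_eq_zero K _ _ (by cases h : ξ (i : ℕ) <;> simp [h])
  hba i := cmat_comp_eq_zero K _ _ (by cases h : ξ (i : ℕ) <;> simp [h])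

section Flags

variable {K V U : Type*} [Field K] [AddCommGroup V] [Module K V] [AddCommGroup U] [Module K U]

/-- A linear map preserves every member of a family of subspaces. -/
def PreservesFlag (𝓕 : Set (Submodule K V)) (φ : V →ₗ[K] V) : Prop :=
  ∀ F ∈ 𝓕, ∀ x ∈ F, φ x ∈ F

/-- A chain of subspaces containing the zero subspace and the whole space. -/
structure IsFlag (𝓕 : Set (Submodule K V)) : Prop where
  isChain : IsChain (· ≤ ·) 𝓕
  bot_mem : ⊥ ∈ 𝓕
  top_mem : ⊤ ∈ 𝓕

lemma isFlag_pair : IsFlag ({⊥, ⊤} : Set (Submodule K V)) where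
  isChain := by
    rintro F (rfl | rfl) G (rfl | rfl) _ <;> simp
  bot_mem := by simp
  top_mem := by simp

/-- The family of subspaces of `U` induced along a pair of maps `a : V → U`, `b : U → V` by a
family of subspaces of `V`. -/
def pushFlag (a : V →ₗ[K] U) (b : U →ₗ[K] V) (𝓕 : Set (Submodule K V)) : Set (Submodule K U) :=
  Submodule.map a '' 𝓕 ∪ Submodule.comap b '' 𝓕

lemma IsFlag.pushFlag {𝓕 : Set (Submodule K V)} (h𝓕 : IsFlag 𝓕) {a : V →ₗ[K] U}
    {b : U →ₗ[K] V} (hba : b.comp a = 0) : IsFlag (pushFlag a b 𝓕) where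
  isChain := by
    have key : ∀ F G : Submodule K V, F.map a ≤ G.comap b := by
      rintro F G _ ⟨x, -, rfl⟩
      have : b (a x) = 0 := LinearMap.congr_fun hba x
      simp [this]
    rintro _ (⟨F, hF, rfl⟩ | ⟨F, hF, rfl⟩) _ (⟨G, hG, rfl⟩ | ⟨G, hG, rfl⟩) _
    · exact (h𝓕.isChain.total hF hG).imp (Submodule.map_mono ·) (Submodule.map_mono ·)
    · exact .inl (key F G)
    · exact .inr (key G F)
    · exact (h𝓕.isChain.total hF hG).imp (Submodule.comap_mono ·) (Submodule.comap_mono ·)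
  bot_mem := .inl ⟨⊥, h𝓕.bot_mem, Submodule.map_bot a⟩
  top_mem := .inr ⟨⊤, h𝓕.top_mem, Submodule.comap_top b⟩

lemma exists_flag_predecessor [FiniteDimensional K V] {𝓕 : Set (Submodule K V)}
    (h𝓕 : IsChain (· ≤ ·) 𝓕) {F : Submodule K V} (hF : ∃ G ∈ 𝓕, G < F) :
    ∃ G ∈ 𝓕, G < F ∧ ∀ H ∈ 𝓕, H < F → H ≤ G := by
  obtain ⟨G, ⟨hG, hGF⟩, hmax⟩ :=
    (wellFounded_gt (α := Submodule K V)).has_min {G | G ∈ 𝓕 ∧ G < F} hF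
  refine ⟨G, hG, hGF, fun H hH hHF => ?_⟩
  rcases h𝓕.total hH hG with h | h
  · exact h
  · by_contra hne
    exact hmax H ⟨hH, hHF⟩ (lt_of_le_not_ge h hne)

lemma exists_projection_preserving_below [FiniteDimensional K V] {𝓕 : Set (Submodule K V)}
    (h𝓕 : IsChain (· ≤ ·) 𝓕) (S F : Submodule K V) (hF : F ∈ 𝓕) :
    ∃ q : V →ₗ[K] V, (∀ x, q x ∈ S ⊓ F) ∧ (∀ x ∈ S ⊓ F, q x = x) ∧
      ∀ G ∈ 𝓕, G ≤ F → ∀ x ∈ G, q x ∈ G := by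
  induction F using WellFoundedLT.induction with
  | _ F ih =>
  obtain ⟨G, q, hGF, hmax, hq_mem, hq_fix, hq_pres⟩ :
      ∃ (G : Submodule K V) (q : V →ₗ[K] V), G ≤ F ∧ (∀ H ∈ 𝓕, H < F → H ≤ G) ∧
        (∀ x, q x ∈ S ⊓ G) ∧ (∀ x ∈ S ⊓ G, q x = x) ∧
        ∀ H ∈ 𝓕, H ≤ G → ∀ x ∈ H, q x ∈ H := by
    by_cases hex : ∃ G ∈ 𝓕, G < F
    · obtain ⟨G, hG, hGF, hmax⟩ := exists_flag_predecessor h𝓕 hex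
      obtain ⟨q, h1, h2, h3⟩ := ih G hGF hG
      exact ⟨G, q, hGF.le, hmax, h1, h2, h3⟩
    · push Not at hex
      refine ⟨⊥, 0, bot_le, fun H hH hHF => absurd hHF (hex H hH), by simp, ?_, by simp⟩
      simp +contextual
  have hdisj : Disjoint (S ⊓ F) (G.map (LinearMap.id - q)) := by
    rw [Submodule.disjoint_def]
    rintro _ hx ⟨x, hxG, rfl⟩
    simp only [LinearMap.sub_apply, LinearMap.id_apply] at hx ⊢
    have hmem : x - q x ∈ S ⊓ G := ⟨hx.1, G.sub_mem hxG (hq_mem x).2⟩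
    rw [← hq_fix _ hmem, map_sub, hq_fix _ (hq_mem x), sub_self]
  obtain ⟨C, hC, hcompl'⟩ := hdisj.symm.exists_isCompl
  have hcompl := hcompl'.symm
  set p := (S ⊓ F).projection C hcompl with hp
  have hp_mem : ∀ x, p x ∈ S ⊓ F := fun x => Submodule.projection_apply_mem hcompl x
  have hp_fix : ∀ x ∈ S ⊓ F, p x = x := fun x hx =>
    Submodule.projection_apply_left hcompl ⟨x, hx⟩
  have hle : S ⊓ G ≤ S ⊓ F := inf_le_inf_left S hGF
  refine ⟨q + p.comp (LinearMap.id - q), fun x => ?_, fun x hx => ?_, fun H hH hHF x hx => ?_⟩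
  · exact Submodule.add_mem _ (hle (hq_mem x)) (hp_mem _)
  · have : p (x - q x) = x - q x := hp_fix _ (Submodule.sub_mem _ hx (hle (hq_mem x)))
    simp [this]
  · rcases hHF.lt_or_eq with hlt | rfl
    · have hHG := hmax H hH hlt
      have : p (x - q x) = 0 := by
        rw [hp, Submodule.projection_apply_eq_zero_iff]
        exact hC ⟨x, hHG hx, rfl⟩
      simpa [this] using hq_pres H hH hHG x hx
    · exact (Submodule.add_mem _ (hle (hq_mem x)) (hp_mem _)).2

/-- Every subspace is the image of a projection preserving a given chain of subspaces. -/
lemma exists_projection_preservesFlag [FiniteDimensional K V] {𝓕 : Set (Submodule K V)}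
    (h𝓕 : IsFlag 𝓕) (S : Submodule K V) :
    ∃ q : V →ₗ[K] V, (∀ x, q x ∈ S) ∧ (∀ x ∈ S, q x = x) ∧ PreservesFlag 𝓕 q := by
  obtain ⟨q, h1, h2, h3⟩ :=
    exists_projection_preserving_below h𝓕.isChain S ⊤ h𝓕.top_mem
  exact ⟨q, fun x => (h1 x).1, fun x hx => h2 x ⟨hx, trivial⟩, fun F hF => h3 F hF le_top⟩

lemma exists_generalized_inverse (f : V →ₗ[K] U) :
    ∃ g : U →ₗ[K] V, ∀ x, f (g (f x)) = f x := by
  obtain ⟨g, hg⟩ := f.rangeRestrict.exists_rightInverse_of_surjective f.range_rangeRestrict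
  obtain ⟨g', hg'⟩ := g.exists_extend
  refine ⟨g', fun x => ?_⟩
  have h1 : g' (f x) = g (f.rangeRestrict x) := LinearMap.congr_fun hg' (f.rangeRestrict x)
  have h2 := LinearMap.congr_fun hg (f.rangeRestrict x)
  rw [h1]
  exact congrArg Subtype.val h2

/-- An endomorphism preserving the induced flag lifts along a pair of maps `a`, `b` with
`a b = 0` and `b a = 0` to an endomorphism preserving the original flag. -/
lemma exists_lift_preservesFlag [FiniteDimensional K V] {𝓕 : Set (Submodule K V)}
    (h𝓕 : IsFlag 𝓕) {a : V →ₗ[K] U} {b : U →ₗ[K] V} (hab : a.comp b = 0)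
    {φ : U →ₗ[K] U} (hφ : PreservesFlag (pushFlag a b 𝓕) φ) :
    ∃ ψ : V →ₗ[K] V, PreservesFlag 𝓕 ψ ∧ (∀ x, φ (a x) = a (ψ x)) ∧
      ∀ y, ψ (b y) = b (φ y) := by
  have hab' : ∀ y, a (b y) = 0 := LinearMap.congr_fun hab
  obtain ⟨e, he_ker, he_fix, he⟩ := exists_projection_preservesFlag h𝓕 (LinearMap.ker a)
  obtain ⟨q, hq_range, hq_fix, hq⟩ := exists_projection_preservesFlag h𝓕 (LinearMap.range b)
  obtain ⟨s, hs⟩ := exists_generalized_inverse a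
  obtain ⟨t, ht⟩ := exists_generalized_inverse b
  have hbt : ∀ x, b (t (q x)) = q x := fun x => by
    obtain ⟨y, hy⟩ := hq_range x
    rw [← hy, ht]
  have hse : ∀ x, s (a x) - e (s (a x)) = x - e x := fun x => by
    have h1 : s (a x) - x ∈ LinearMap.ker a := by simp [hs]
    have h2 := he_fix _ h1
    rw [map_sub] at h2
    rw [sub_eq_sub_iff_sub_eq_sub, h2]
  have hae : ∀ x, a (e x) = 0 := he_ker
  refine ⟨b ∘ₗ φ ∘ₗ t ∘ₗ q + (LinearMap.id - e) ∘ₗ s ∘ₗ φ ∘ₗ a, fun F hF x hx => ?_, fun x => ?_,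
    fun y => ?_⟩
  · refine F.add_mem ?_ ?_
    · refine hφ _ (.inr ⟨F, hF, rfl⟩) (t (q x)) ?_
      simpa [hbt] using hq F hF x hx
    · obtain ⟨y, hy, hyx⟩ := hφ _ (.inl ⟨F, hF, rfl⟩) (a x) ⟨x, hx, rfl⟩
      simp only [LinearMap.comp_apply, LinearMap.sub_apply, LinearMap.id_apply, ← hyx, hse]
      exact F.sub_mem hy (he F hF y hy)
  · obtain ⟨y, -, hyx⟩ := hφ _ (.inl ⟨⊤, h𝓕.top_mem, rfl⟩) (a x) ⟨x, trivial, rfl⟩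
    simp [hab', hae, ← hyx, hs]
  · have h1 : t (b y) - y ∈ Submodule.comap b ⊥ := by simp [ht]
    have h2 := hφ _ (.inr ⟨⊥, h𝓕.bot_mem, rfl⟩) _ h1
    simp only [Submodule.mem_comap, Submodule.mem_bot, map_sub, sub_eq_zero] at h2
    simp [hab', hq_fix (b y) ⟨y, rfl⟩, h2]

/-- On a nonzero space, two flags are preserved by a common projection onto a line. -/
lemma exists_line_projection_preservesFlag [FiniteDimensional K V] [Nontrivial V]
    {𝓛 𝓡 : Set (Submodule K V)} (h𝓛 : IsFlag 𝓛) (h𝓡 : IsFlag 𝓡) :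
    ∃ (w : V) (φ : V →ₗ[K] V), w ≠ 0 ∧ φ w = w ∧ (∀ x, φ x ∈ Submodule.span K {w}) ∧
      PreservesFlag 𝓛 φ ∧ PreservesFlag 𝓡 φ := by
  obtain ⟨F, ⟨hF, hF0⟩, hmin⟩ := (wellFounded_lt (α := Submodule K V)).has_min
    {F | F ∈ 𝓛 ∧ F ≠ ⊥} ⟨⊤, h𝓛.top_mem, top_ne_bot⟩
  obtain ⟨w, hwF, hw⟩ := F.exists_mem_ne_zero_of_ne_bot hF0
  have hwmem : ∀ G ∈ 𝓛, G ≠ ⊥ → w ∈ G := fun G hG hG0 => by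
    rcases h𝓛.isChain.total hF hG with h | h
    · exact h hwF
    · rcases h.lt_or_eq with h | rfl
      · exact absurd h (hmin G ⟨hG, hG0⟩)
      · exact hwF
  have hsup : w ∉ sSup {G | G ∈ 𝓡 ∧ w ∉ G} := by
    rw [Submodule.mem_sSup_of_directed (s := {G | G ∈ 𝓡 ∧ w ∉ G})
      ⟨⊥, h𝓡.bot_mem, by simpa using hw⟩]
    · rintro ⟨G, ⟨-, hG⟩, hwG⟩
      exact hG hwG
    · exact (h𝓡.isChain.mono fun G hG => hG.1).directedOn
  have hdisj : Disjoint (Submodule.span K {w}) (sSup {G | G ∈ 𝓡 ∧ w ∉ G}) :=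
    (Submodule.disjoint_span_singleton' hw).2 hsup |>.symm
  obtain ⟨C, hC, hcompl'⟩ := hdisj.symm.exists_isCompl
  have hcompl := hcompl'.symm
  set φ := (Submodule.span K {w}).projection C hcompl with hφ
  have hmem : ∀ x, φ x ∈ Submodule.span K {w} := fun x =>
    Submodule.projection_apply_mem hcompl x
  have hpres : ∀ G : Submodule K V, w ∈ G → ∀ x, φ x ∈ G := fun G hG x =>
    (Submodule.span_singleton_le_iff_mem w G).2 hG (hmem x)
  refine ⟨w, φ, hw, Submodule.projection_apply_left hcompl
    ⟨w, Submodule.mem_span_singleton_self w⟩, hmem, fun G hG x hx => ?_, fun G hG x hx => ?_⟩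
  · by_cases hG0 : G = ⊥
    · subst hG0
      simp_all
    · exact hpres G (hwmem G hG hG0) x
  · by_cases hwG : w ∈ G
    · exact hpres G hwG x
    · have : φ x = 0 := by
        rw [hφ, Submodule.projection_apply_eq_zero_iff]
        exact hC (le_sSup (show G ∈ {G | G ∈ 𝓡 ∧ w ∉ G} from ⟨hG, hwG⟩) hx)
      simp [this]

end Flags

namespace ARep

variable {K : Type} [Field K] {r : ℕ}

/-- A family of endomorphisms of the vertex spaces commutes with both arrows between the vertices
`i` and `i + 1`. -/
def CommutesAt (M : ARep K r) (Φ : ∀ j, M.V j →ₗ[K] M.V j) (i : Fin r) : Prop :=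
  (∀ x, Φ i.succ (M.a i x) = M.a i (Φ i.castSucc x)) ∧
    ∀ y, Φ i.castSucc (M.b i y) = M.b i (Φ i.succ y)

/-- The flag on each vertex space induced by the part of the representation to its left. -/
def leftFlag (M : ARep K r) (i : Fin (r + 1)) : Set (Submodule K (M.V i)) :=
  Fin.induction (motive := fun i => Set (Submodule K (M.V i))) {⊥, ⊤}
    (fun i 𝓕 => pushFlag (M.a i) (M.b i) 𝓕) i

/-- The flag on each vertex space induced by the part of the representation to its right. -/
def rightFlag (M : ARep K r) (i : Fin (r + 1)) : Set (Submodule K (M.V i)) :=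
  Fin.reverseInduction (motive := fun i => Set (Submodule K (M.V i))) {⊥, ⊤}
    (fun i 𝓕 => pushFlag (M.b i) (M.a i) 𝓕) i

lemma leftFlag_succ (M : ARep K r) (i : Fin r) :
    M.leftFlag i.succ = pushFlag (M.a i) (M.b i) (M.leftFlag i.castSucc) := rfl

lemma rightFlag_castSucc (M : ARep K r) (i : Fin r) :
    M.rightFlag i.castSucc = pushFlag (M.b i) (M.a i) (M.rightFlag i.succ) :=
  Fin.reverseInduction_castSucc (motive := fun i => Set (Submodule K (M.V i))) i

lemma isFlag_leftFlag (M : ARep K r) (i : Fin (r + 1)) : IsFlag (M.leftFlag i) := by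
  induction i using Fin.induction with
  | zero => exact isFlag_pair
  | succ i ih => exact ih.pushFlag (M.hba i)

lemma isFlag_rightFlag (M : ARep K r) (i : Fin (r + 1)) : IsFlag (M.rightFlag i) := by
  induction i using Fin.reverseInduction with
  | last =>
    rw [rightFlag, Fin.reverseInduction_last]
    exact isFlag_pair
  | cast i ih =>
    rw [rightFlag_castSucc]
    exact ih.pushFlag (M.hab i)

lemma exists_extension_left (M : ARep K r) (i : Fin (r + 1)) (φ : M.V i →ₗ[K] M.V i)
    (hφ : PreservesFlag (M.leftFlag i) φ) :
    ∃ Φ : ∀ j, M.V j →ₗ[K] M.V j, Φ i = φ ∧ ∀ j : Fin r, j.succ ≤ i → M.CommutesAt Φ j := by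
  induction i using Fin.induction with
  | zero =>
    refine ⟨Function.update 0 0 φ, by simp, fun j hj => ?_⟩
    simp at hj
  | succ i ih =>
    obtain ⟨ψ, hψ, hψa, hψb⟩ :=
      exists_lift_preservesFlag (M.isFlag_leftFlag i.castSucc) (M.hab i) hφ
    obtain ⟨Φ, hΦ, hcomm⟩ := ih ψ hψ
    refine ⟨Function.update Φ i.succ φ, by simp, fun j hj => ?_⟩
    rcases hj.eq_or_lt with h | h
    · obtain rfl := Fin.succ_injective _ h
      have hne : j.castSucc ≠ j.succ := Fin.castSucc_lt_succ.ne
      simp only [CommutesAt, Function.update_self, Function.update_of_ne hne, hΦ]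
      exact ⟨hψa, hψb⟩
    · have hne : j.castSucc ≠ i.succ := (Fin.castSucc_lt_succ.trans h).ne
      have := hcomm j (Fin.le_castSucc_iff.2 h)
      simpa only [CommutesAt, Function.update_of_ne hne, Function.update_of_ne h.ne] using this

lemma exists_extension_right (M : ARep K r) (i : Fin (r + 1)) (φ : M.V i →ₗ[K] M.V i)
    (hφ : PreservesFlag (M.rightFlag i) φ) :
    ∃ Φ : ∀ j, M.V j →ₗ[K] M.V j,
      Φ i = φ ∧ ∀ j : Fin r, i ≤ j.castSucc → M.CommutesAt Φ j := by
  induction i using Fin.reverseInduction with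
  | last =>
    refine ⟨Function.update 0 (Fin.last r) φ, by simp, fun j hj => ?_⟩
    exact absurd (Fin.castSucc_lt_last j) hj.not_gt
  | cast i ih =>
    rw [rightFlag_castSucc] at hφ
    obtain ⟨ψ, hψ, hψb, hψa⟩ :=
      exists_lift_preservesFlag (M.isFlag_rightFlag i.succ) (M.hba i) hφ
    obtain ⟨Φ, hΦ, hcomm⟩ := ih ψ hψ
    refine ⟨Function.update Φ i.castSucc φ, by simp, fun j hj => ?_⟩
    rcases hj.eq_or_lt with h | h
    · obtain rfl := Fin.castSucc_injective _ h
      have hne : i.succ ≠ i.castSucc := Fin.castSucc_lt_succ.ne'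
      simp only [CommutesAt, Function.update_self, Function.update_of_ne hne, hΦ]
      exact ⟨hψa, hψb⟩
    · have hne : j.succ ≠ i.castSucc := (h.trans Fin.castSucc_lt_succ).ne'
      have := hcomm j (Fin.succ_le_castSucc_iff.2 (Fin.castSucc_lt_castSucc_iff.1 h))
      simpa only [CommutesAt, Function.update_of_ne hne, Function.update_of_ne h.ne'] using this

/-- An endomorphism of one vertex space preserving both flags extends to an endomorphism of the
representation. -/
lemma exists_extension (M : ARep K r) (i : Fin (r + 1)) (φ : M.V i →ₗ[K] M.V i)
    (hL : PreservesFlag (M.leftFlag i) φ) (hR : PreservesFlag (M.rightFlag i) φ) :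
    ∃ Φ : ∀ j, M.V j →ₗ[K] M.V j, Φ i = φ ∧ ∀ j, M.CommutesAt Φ j := by
  obtain ⟨Φ, hΦ, hΦc⟩ := M.exists_extension_left i φ hL
  obtain ⟨Ψ, hΨ, hΨc⟩ := M.exists_extension_right i φ hR
  have hΨ_of_le : ∀ j, i ≤ j → (if j ≤ i then Φ j else Ψ j) = Ψ j := fun j hj => by
    split_ifs with h
    · obtain rfl := le_antisymm h hj
      rw [hΦ, hΨ]
    · rfl
  refine ⟨fun j => if j ≤ i then Φ j else Ψ j, by simp [hΦ], fun j => ?_⟩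
  rcases le_or_gt j.succ i with h | h
  · have hle : j.castSucc ≤ i := Fin.castSucc_lt_succ.le.trans h
    simpa only [CommutesAt, h, hle, if_true] using hΦc j h
  · have hle : i ≤ j.castSucc := Fin.le_castSucc_iff.2 h
    simpa only [CommutesAt, hΨ_of_le _ h.le, hΨ_of_le _ hle] using hΨc j hle

/-- Fitting's lemma: an endomorphism of an indecomposable representation is injective or has no
nonzero fixed vector. -/
lemma Indec.injective_or_fixed_eq_zero {M : ARep K r} (hM : M.Indec)
    {Φ : ∀ j, M.V j →ₗ[K] M.V j} (hΦ : ∀ j, M.CommutesAt Φ j) :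
    (∀ i, Function.Injective (Φ i)) ∨ ∀ i x, Φ i x = x → x = 0 := by
  have ha : ∀ (n : ℕ) (i : Fin r) x,
      (Φ i.succ ^ n) (M.a i x) = M.a i ((Φ i.castSucc ^ n) x) := fun n i => by
    induction n with
    | zero => simp
    | succ n ih => intro x; simp [pow_succ, (hΦ i).1, ih]
  have hb : ∀ (n : ℕ) (i : Fin r) x,
      (Φ i.castSucc ^ n) (M.b i x) = M.b i ((Φ i.succ ^ n) x) := fun n i => by
    induction n with
    | zero => simp
    | succ n ih => intro x; simp [pow_succ, (hΦ i).2, ih]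
  have hker : M.IsSubrep fun i => ⨆ n : ℕ, LinearMap.ker (Φ i ^ n) := by
    constructor
    · intro i
      change (⨆ n : ℕ, LinearMap.ker (Φ i.castSucc ^ n)) ≤
        Submodule.comap (M.a i) (⨆ n : ℕ, LinearMap.ker (Φ i.succ ^ n))
      refine iSup_le fun n x hx => Submodule.mem_iSup_of_mem n ?_
      rw [LinearMap.mem_ker] at hx ⊢
      rw [ha, hx, map_zero]
    · intro i
      change (⨆ n : ℕ, LinearMap.ker (Φ i.succ ^ n)) ≤
        Submodule.comap (M.b i) (⨆ n : ℕ, LinearMap.ker (Φ i.castSucc ^ n))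
      refine iSup_le fun n x hx => Submodule.mem_iSup_of_mem n ?_
      rw [LinearMap.mem_ker] at hx ⊢
      rw [hb, hx, map_zero]
  have hrange : M.IsSubrep fun i => ⨅ n : ℕ, LinearMap.range (Φ i ^ n) := by
    constructor <;> intro i x hx <;> rw [Submodule.mem_iInf] at hx ⊢ <;> intro n <;>
      obtain ⟨y, rfl⟩ := hx n
    · exact ⟨M.a i y, ha n i y⟩
    · exact ⟨M.b i y, hb n i y⟩
  refine (hM.2 _ _ hker hrange fun i => (Φ i).isCompl_iSup_ker_pow_iInf_range_pow).imp ?_ ?_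
  · intro h i
    rw [← LinearMap.ker_eq_bot, eq_bot_iff, ← h i]
    exact le_iSup_of_le 1 (by simp)
  · intro h i x hx
    rw [← Submodule.mem_bot K, ← h i, Submodule.mem_iInf]
    intro n
    refine ⟨x, ?_⟩
    induction n with
    | zero => simp
    | succ n ih => rw [pow_succ, Module.End.mul_apply, hx, ih]

lemma Indec.finrank_le_one {M : ARep K r} (hM : M.Indec) (i : Fin (r + 1)) :
    Module.finrank K (M.V i) ≤ 1 := by
  rcases subsingleton_or_nontrivial (M.V i) with h | h
  · simp [Module.finrank_zero_of_subsingleton]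
  · obtain ⟨w, φ, hw, hφw, hφ, hL, hR⟩ :=
      exists_line_projection_preservesFlag (M.isFlag_leftFlag i) (M.isFlag_rightFlag i)
    obtain ⟨Φ, rfl, hcomm⟩ := M.exists_extension i φ hL hR
    rcases hM.injective_or_fixed_eq_zero hcomm with hinj | hfix
    · refine _root_.finrank_le_one w fun x => ?_
      obtain ⟨c, hc⟩ := Submodule.mem_span_singleton.1 (hφ x)
      exact ⟨c, hinj i (by rw [map_smul, hφw, hc])⟩
    · exact absurd (hfix i w hφw) hw

lemma Indec.edge_ne_zero {M : ARep K r} (hM : M.Indec) {j k : Fin (r + 1)} (i : Fin r)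
    [Nontrivial (M.V j)] [Nontrivial (M.V k)] (hj : j ≤ i.castSucc) (hk : i.succ ≤ k) :
    M.a i ≠ 0 ∨ M.b i ≠ 0 := by
  by_contra! h
  have hcomm : ∀ l, M.CommutesAt (fun l => if l ≤ i.castSucc then LinearMap.id else 0) l := by
    intro l
    rcases lt_trichotomy l i with hl | rfl | hl
    · have h1 : l.succ ≤ i.castSucc := Fin.succ_le_castSucc_iff.2 hl
      have h2 : l.castSucc ≤ i.castSucc := Fin.castSucc_le_castSucc_iff.2 hl.le
      simp [CommutesAt, h1, h2]
    · simp [CommutesAt, h.1, h.2]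
    · have h1 : ¬ l.castSucc ≤ i.castSucc := by simpa using hl
      have h2 : ¬ l.succ ≤ i.castSucc := fun h => h1 (Fin.castSucc_lt_succ.le.trans h)
      simp only [CommutesAt, h1, h2, if_false]
      simp
  rcases hM.injective_or_fixed_eq_zero hcomm with hinj | hfix
  · obtain ⟨x, hx⟩ := exists_ne (0 : M.V k)
    have hk' : ¬ k ≤ i.castSucc := (Fin.castSucc_lt_succ.trans_le hk).not_ge
    exact hx (hinj k (by simp [hk']))
  · obtain ⟨x, hx⟩ := exists_ne (0 : M.V j)
    exact hx (hfix j x (by simp [hj]))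

end ARep

section Generators

variable {K V U : Type*} [Field K] [AddCommGroup V] [Module K V] [AddCommGroup U] [Module K U]

/-- The vector `g`, possibly zero, spans the whole space. -/
def IsGen (K : Type*) {V : Type*} [Field K] [AddCommGroup V] [Module K V] (g : V) : Prop :=
  ∀ x : V, ∃ c : K, c • g = x

lemma IsGen.eq_zero {g : V} (hg : IsGen K g) (h0 : g = 0) (x : V) : x = 0 := by
  obtain ⟨c, rfl⟩ := hg x
  simp [h0]

lemma IsGen.nontrivial_iff {g : V} (hg : IsGen K g) : Nontrivial V ↔ g ≠ 0 :=
  ⟨fun _ h0 => let ⟨x, hx⟩ := exists_ne (0 : V); hx (hg.eq_zero h0 x), fun h => ⟨g, 0, h⟩⟩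

lemma IsGen.linearMap_eq_zero {g : V} (hg : IsGen K g) {f : V →ₗ[K] U} (hf : f g = 0) :
    f = 0 := by
  ext x
  obtain ⟨c, rfl⟩ := hg x
  simp [hf]

lemma isGen_of_ne_zero [FiniteDimensional K V] (hV : Module.finrank K V ≤ 1) {g : V}
    (hg : g ≠ 0) : IsGen K g := by
  obtain ⟨v, hv⟩ := finrank_le_one_iff.1 hV
  obtain ⟨c, rfl⟩ := hv g
  intro x
  obtain ⟨d, rfl⟩ := hv x
  have hc : c ≠ 0 := by
    rintro rfl
    simp at hg
  exact ⟨d * c⁻¹, by rw [smul_smul, inv_mul_cancel_right₀ hc]⟩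

lemma IsGen.exists_linearEquiv {g : V} {g' : U} (hg : IsGen K g) (hg' : IsGen K g')
    (h : g = 0 ↔ g' = 0) : ∃ f : V ≃ₗ[K] U, f g = g' := by
  by_cases h0 : g = 0
  · have : Subsingleton V := ⟨fun x y => by rw [hg.eq_zero h0 x, hg.eq_zero h0 y]⟩
    have : Subsingleton U :=
      ⟨fun x y => by rw [hg'.eq_zero (h.1 h0) x, hg'.eq_zero (h.1 h0) y]⟩
    exact ⟨LinearEquiv.ofBijective 0 (Function.bijective_iff_existsUnique _ |>.2 fun y =>
      ⟨0, Subsingleton.elim _ _, fun _ _ => Subsingleton.elim _ _⟩), Subsingleton.elim _ _⟩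
  · let e : K ≃ₗ[K] V := LinearEquiv.ofBijective (LinearMap.toSpanSingleton K V g)
      ⟨smul_left_injective K h0, hg⟩
    let e' : K ≃ₗ[K] U := LinearEquiv.ofBijective (LinearMap.toSpanSingleton K U g')
      ⟨smul_left_injective K (h0 ∘ h.2), hg'⟩
    have he : e 1 = g := one_smul K g
    have he' : e' 1 = g' := one_smul K g'
    exact ⟨e.symm.trans e', by simp [← he, ← he']⟩

lemma IsGen.mem_or_mem {g : V} (hg : IsGen K g) {W W' : Submodule K V} (h : IsCompl W W') :
    g ∈ W ∨ g ∈ W' := by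
  obtain ⟨w, hw, w', hw', hsum⟩ := Submodule.mem_sup.1 (h.sup_eq_top ▸ Submodule.mem_top (x := g))
  obtain ⟨c, rfl⟩ := hg w
  by_cases hc : c = 0
  · right
    rw [hc, zero_smul, zero_add] at hsum
    exact hsum ▸ hw'
  · exact .inl ((W.smul_mem_iff hc).1 hw)

lemma isGen_const_one {d : ℕ} (hd : d ≤ 1) : IsGen K (fun _ => 1 : Fin d → K) := by
  intro v
  interval_cases d
  · exact ⟨0, Subsingleton.elim _ _⟩
  · exact ⟨v 0, funext fun i => (mul_one _).trans (congrArg v (Subsingleton.elim 0 i))⟩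

end Generators

lemma cmat_const_one (K : Type) [Field K] {d e : ℕ} (hd : d = 1) (c : K) :
    cmat K c (fun _ => 1 : Fin d → K) = c • (fun _ => 1 : Fin e → K) := by
  subst hd
  ext i
  simp [cmat, Matrix.mulVec, dotProduct]

namespace ARep

variable {K : Type} [Field K] {r : ℕ}

/-- Two representations whose vertex spaces have compatible generators, on which the arrows act by
the same scalars, are isomorphic. -/
lemma iso_of_isGen {M N : ARep K r} {g : ∀ i, M.V i} {g' : ∀ i, N.V i}
    (hg : ∀ i, IsGen K (g i)) (hg' : ∀ i, IsGen K (g' i)) (h0 : ∀ i, g i = 0 ↔ g' i = 0)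
    (ha : ∀ i : Fin r, g i.castSucc ≠ 0 → g i.succ ≠ 0 → ∃ c : K,
      M.a i (g i.castSucc) = c • g i.succ ∧ N.a i (g' i.castSucc) = c • g' i.succ)
    (hb : ∀ i : Fin r, g i.castSucc ≠ 0 → g i.succ ≠ 0 → ∃ c : K,
      M.b i (g i.succ) = c • g i.castSucc ∧ N.b i (g' i.succ) = c • g' i.castSucc) :
    M.Iso N := by
  choose f hf using fun i => (hg i).exists_linearEquiv (hg' i) (h0 i)
  refine ⟨f, fun i x => ?_, fun i x => ?_⟩
  · by_cases h : g i.castSucc ≠ 0 ∧ g i.succ ≠ 0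
    · obtain ⟨c, hM, hN⟩ := ha i h.1 h.2
      obtain ⟨d, rfl⟩ := hg _ x
      simp only [map_smul, hM, hN, hf]
    · by_cases h1 : g i.castSucc = 0
      · simp [(hg _).eq_zero h1 x]
      · have h2 : g i.succ = 0 := by tauto
        rw [(hg _).eq_zero h2 (M.a i x), (hg' _).eq_zero ((h0 _).1 h2) (N.a i _), map_zero]
  · by_cases h : g i.castSucc ≠ 0 ∧ g i.succ ≠ 0
    · obtain ⟨c, hM, hN⟩ := hb i h.1 h.2
      obtain ⟨d, rfl⟩ := hg _ x
      simp only [map_smul, hM, hN, hf]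
    · by_cases h1 : g i.succ = 0
      · simp [(hg _).eq_zero h1 x]
      · have h2 : g i.castSucc = 0 := by tauto
        rw [(hg _).eq_zero h2 (M.b i x), (hg' _).eq_zero ((h0 _).1 h2) (N.b i _), map_zero]

lemma IsSubrep.eq_bot_of_mem {M : ARep K r} {g : ∀ i, M.V i} (hg : ∀ i, IsGen K (g i))
    {k₁ k₂ : Fin (r + 1)} (h0 : ∀ i, g i ≠ 0 ↔ k₁ ≤ i ∧ i ≤ k₂)
    (hedge : ∀ i : Fin r, k₁ ≤ i.castSucc → i.succ ≤ k₂ →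
      M.a i (g i.castSucc) = g i.succ ∨ M.b i (g i.succ) = g i.castSucc)
    {W W' : ∀ i, Submodule K (M.V i)} (hW : M.IsSubrep W) (hW' : M.IsSubrep W')
    (hcompl : ∀ i, IsCompl (W i) (W' i)) (hmem : g k₁ ∈ W k₁) (i : Fin (r + 1)) : W' i = ⊥ := by
  have hnot : ∀ i, g i ≠ 0 → g i ∈ W i → g i ∉ W' i := fun i hi h h' =>
    hi ((Submodule.disjoint_def.1 (hcompl i).disjoint) _ h h')
  have key : ∀ i, k₁ ≤ i → i ≤ k₂ → g i ∈ W i := by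
    intro i
    induction i using Fin.induction with
    | zero =>
      intro h _
      obtain rfl := Fin.le_zero_iff.1 h
      exact hmem
    | succ i ih =>
      intro h1 h2
      rcases h1.eq_or_lt with rfl | h1
      · exact hmem
      have h1' := Fin.le_castSucc_iff.2 h1
      have h2' := Fin.castSucc_lt_succ.le.trans h2
      have hi := ih h1' h2'
      rcases hedge i h1' h2 with h | h
      · exact h ▸ hW.1 i _ hi
      · refine ((hg _).mem_or_mem (hcompl i.succ)).resolve_right fun hmem' => ?_
        exact hnot _ ((h0 _).2 ⟨h1', h2'⟩) hi (h ▸ hW'.2 i _ hmem')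
  by_cases hi : g i = 0
  · exact (Submodule.eq_bot_iff _).2 fun x _ => (hg i).eq_zero hi x
  · obtain ⟨h1, h2⟩ := (h0 i).1 hi
    have htop : W i = ⊤ := by
      rw [eq_top_iff]
      intro x _
      obtain ⟨c, rfl⟩ := hg i x
      exact (W i).smul_mem c (key i h1 h2)
    simpa [htop] using (hcompl i).inf_eq_bot

/-- A representation with vertex spaces of dimension one on an interval and zero elsewhere is
indecomposable if on each edge of the interval some arrow is an isomorphism. -/
lemma indec_of_isGen {M : ARep K r} {g : ∀ i, M.V i} (hg : ∀ i, IsGen K (g i))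
    {k₁ k₂ : Fin (r + 1)} (hk : k₁ ≤ k₂) (h0 : ∀ i, g i ≠ 0 ↔ k₁ ≤ i ∧ i ≤ k₂)
    (hedge : ∀ i : Fin r, k₁ ≤ i.castSucc → i.succ ≤ k₂ →
      M.a i (g i.castSucc) = g i.succ ∨ M.b i (g i.succ) = g i.castSucc) : M.Indec := by
  refine ⟨⟨k₁, (hg k₁).nontrivial_iff.2 ((h0 k₁).2 ⟨le_rfl, hk⟩)⟩,
    fun W W' hW hW' hcompl => ?_⟩
  rcases (hg k₁).mem_or_mem (hcompl k₁) with h | h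
  · exact .inr (hW.eq_bot_of_mem hg h0 hedge hW' hcompl h)
  · exact .inl (hW'.eq_bot_of_mem hg h0 hedge hW (fun i => (hcompl i).symm) h)

lemma Iso.nontrivial_iff {M N : ARep K r} (h : M.Iso N) (i : Fin (r + 1)) :
    Nontrivial (M.V i) ↔ Nontrivial (N.V i) :=
  let ⟨f, _⟩ := h
  (f i).toEquiv.nontrivial_congr

/-- A representation with vertex spaces of dimension at most one has a family of generators
compatible with all nonzero arrows. -/
lemma exists_isGen {M : ARep K r} (hM : ∀ i, Module.finrank K (M.V i) ≤ 1) :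
    ∃ g : ∀ i, M.V i, (∀ i, IsGen K (g i)) ∧
      ∀ i, (M.a i ≠ 0 → M.a i (g i.castSucc) = g i.succ) ∧
        (M.b i ≠ 0 → M.b i (g i.succ) = g i.castSucc) := by
  have hex : ∀ i, ∃ y : M.V i, IsGen K y := fun i => finrank_le_one_iff.1 (hM i)
  have step : ∀ (i : Fin r) (x : {x : M.V i.castSucc // IsGen K x}),
      ∃ y : {y : M.V i.succ // IsGen K y},
        (M.a i ≠ 0 → M.a i x = y) ∧ (M.b i ≠ 0 → M.b i y = x) := by
    rintro i ⟨x, hx⟩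
    by_cases ha : M.a i = 0
    · by_cases hb : M.b i = 0
      · obtain ⟨y, hy⟩ := hex i.succ
        exact ⟨⟨y, hy⟩, absurd ha, absurd hb⟩
      · obtain ⟨y, hy⟩ := hex i.succ
        have hby : M.b i y ≠ 0 := fun h => hb (hy.linearMap_eq_zero h)
        obtain ⟨c, hc⟩ := isGen_of_ne_zero (hM _) hby x
        have hx0 : x ≠ 0 := fun h => hby (hx.eq_zero h _)
        have hcy : c • y ≠ 0 := fun h => hx0 (by rw [← hc, ← map_smul, h, map_zero])
        exact ⟨⟨c • y, isGen_of_ne_zero (hM _) hcy⟩, absurd ha, fun _ => by simpa using hc⟩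
    · have hax : M.a i x ≠ 0 := fun h => ha (hx.linearMap_eq_zero h)
      have hgen : IsGen K (M.a i x) := isGen_of_ne_zero (hM _) hax
      refine ⟨⟨M.a i x, hgen⟩, fun _ => rfl, fun hb => absurd ?_ hb⟩
      exact hgen.linearMap_eq_zero (LinearMap.congr_fun (M.hba i) x)
  choose next hnext using step
  obtain ⟨y, hy⟩ := hex 0
  let g : ∀ i, {x : M.V i // IsGen K x} := fun i =>
    Fin.induction (motive := fun i => {x : M.V i // IsGen K x}) ⟨y, hy⟩ next i
  exact ⟨fun i => g i, fun i => (g i).2, fun i => hnext i (g i.castSucc)⟩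

/-- The support of an indecomposable representation is an interval, on each edge of which some
arrow is nonzero. -/
lemma Indec.exists_interval {M : ARep K r} (hM : M.Indec) :
    ∃ k₁ k₂ : Fin (r + 1), k₁ ≤ k₂ ∧ (∀ i, Nontrivial (M.V i) ↔ k₁ ≤ i ∧ i ≤ k₂) ∧
      ∀ i : Fin r, k₁ ≤ i.castSucc → i.succ ≤ k₂ → M.a i ≠ 0 ∨ M.b i ≠ 0 := by
  classical
  have hS : (Finset.univ.filter fun i => Nontrivial (M.V i)).Nonempty := by
    obtain ⟨i, hi⟩ := hM.1
    exact ⟨i, by simpa using hi⟩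
  set S := Finset.univ.filter fun i => Nontrivial (M.V i) with hSdef
  have hmem : ∀ i, i ∈ S ↔ Nontrivial (M.V i) := by simp [hSdef]
  have h1 : Nontrivial (M.V (S.min' hS)) := (hmem _).1 (S.min'_mem hS)
  have h2 : Nontrivial (M.V (S.max' hS)) := (hmem _).1 (S.max'_mem hS)
  have hedge : ∀ i : Fin r, S.min' hS ≤ i.castSucc → i.succ ≤ S.max' hS →
      M.a i ≠ 0 ∨ M.b i ≠ 0 := fun i hi hi' => hM.edge_ne_zero i hi hi'
  refine ⟨S.min' hS, S.max' hS, S.min'_le _ (S.max'_mem hS), fun i => ⟨fun hi => ?_, ?_⟩, hedge⟩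
  · exact ⟨S.min'_le i ((hmem i).2 hi), S.le_max' i ((hmem i).2 hi)⟩
  · rintro ⟨hi1, hi2⟩
    rcases hi2.eq_or_lt with rfl | hi2
    · exact h2
    obtain ⟨j, rfl⟩ := Fin.exists_castSucc_eq.2 (Fin.ne_last_of_lt hi2)
    by_contra hcon
    rw [not_nontrivial_iff_subsingleton] at hcon
    rcases hedge j hi1 (Fin.castSucc_lt_iff_succ_le.1 hi2) with h | h
    · exact h (LinearMap.ext fun x => by rw [Subsingleton.elim x 0, map_zero, map_zero])
    · exact h (LinearMap.ext fun x => Subsingleton.elim _ _)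

end ARep

section Models

variable (K : Type) [Field K] (r : ℕ)

/-- The standard generators of the vertex spaces of `S_j`. -/
def srepGen (j i : Fin (r + 1)) : (Srep K r j).V i := fun _ => 1

/-- The standard generators of the vertex spaces of `M(k₁, k₂, ξ)`. -/
def mrepGen (k₁ k₂ : Fin (r + 1)) (ξ : ℕ → Bool) (i : Fin (r + 1)) :
    (Mrep K r k₁ k₂ ξ).V i := fun _ => 1

variable {r}

lemma isGen_srepGen (j i : Fin (r + 1)) : IsGen K (srepGen K r j i) :=
  isGen_const_one (by split_ifs <;> simp)

lemma isGen_mrepGen (k₁ k₂ : Fin (r + 1)) (ξ : ℕ → Bool) (i : Fin (r + 1)) :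
    IsGen K (mrepGen K r k₁ k₂ ξ i) :=
  isGen_const_one (by split_ifs <;> simp)

lemma const_one_ne_zero_iff {d : ℕ} : (fun _ => 1 : Fin d → K) ≠ 0 ↔ d ≠ 0 := by
  refine ⟨?_, fun hd h => one_ne_zero (congrFun h ⟨0, Nat.pos_of_ne_zero hd⟩)⟩
  rintro h rfl
  exact h (Subsingleton.elim _ _)

lemma srepGen_ne_zero_iff (j i : Fin (r + 1)) : srepGen K r j i ≠ 0 ↔ i = j :=
  (const_one_ne_zero_iff K).trans (by simp)

lemma mrepGen_ne_zero_iff (k₁ k₂ : Fin (r + 1)) (ξ : ℕ → Bool) (i : Fin (r + 1)) :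
    mrepGen K r k₁ k₂ ξ i ≠ 0 ↔ k₁ ≤ i ∧ i ≤ k₂ :=
  (const_one_ne_zero_iff K).trans (by simp)

lemma mrep_a_gen {k₁ k₂ : Fin (r + 1)} (ξ : ℕ → Bool) {i : Fin r} (h₁ : k₁ ≤ i.castSucc)
    (h₂ : i.succ ≤ k₂) :
    (Mrep K r k₁ k₂ ξ).a i (mrepGen K r k₁ k₂ ξ i.castSucc) =
      (if ξ i then 1 else 0 : K) • mrepGen K r k₁ k₂ ξ i.succ :=
  cmat_const_one K (if_pos ⟨h₁, Fin.castSucc_lt_succ.le.trans h₂⟩) _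

lemma mrep_b_gen {k₁ k₂ : Fin (r + 1)} (ξ : ℕ → Bool) {i : Fin r} (h₁ : k₁ ≤ i.castSucc)
    (h₂ : i.succ ≤ k₂) :
    (Mrep K r k₁ k₂ ξ).b i (mrepGen K r k₁ k₂ ξ i.succ) =
      (if ξ i then 0 else 1 : K) • mrepGen K r k₁ k₂ ξ i.castSucc :=
  cmat_const_one K (if_pos ⟨h₁.trans Fin.castSucc_lt_succ.le, h₂⟩) _

lemma nontrivial_srep_iff (j i : Fin (r + 1)) : Nontrivial ((Srep K r j).V i) ↔ i = j :=
  (isGen_srepGen K j i).nontrivial_iff.trans (srepGen_ne_zero_iff K j i)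

lemma nontrivial_mrep_iff (k₁ k₂ : Fin (r + 1)) (ξ : ℕ → Bool) (i : Fin (r + 1)) :
    Nontrivial ((Mrep K r k₁ k₂ ξ).V i) ↔ k₁ ≤ i ∧ i ≤ k₂ :=
  (isGen_mrepGen K k₁ k₂ ξ i).nontrivial_iff.trans (mrepGen_ne_zero_iff K k₁ k₂ ξ i)

lemma srep_indec (j : Fin (r + 1)) : (Srep K r j).Indec := by
  refine ARep.indec_of_isGen (isGen_srepGen K j) le_rfl (k₁ := j) (k₂ := j) (fun i => ?_)
    fun i h₁ h₂ => absurd (h₁.trans_lt Fin.castSucc_lt_succ) h₂.not_gt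
  rw [srepGen_ne_zero_iff, le_antisymm_iff, and_comm]

lemma mrep_indec {k₁ k₂ : Fin (r + 1)} (ξ : ℕ → Bool) (hk : k₁ ≤ k₂) :
    (Mrep K r k₁ k₂ ξ).Indec := by
  refine ARep.indec_of_isGen (isGen_mrepGen K k₁ k₂ ξ) hk (mrepGen_ne_zero_iff K k₁ k₂ ξ)
    fun i h₁ h₂ => ?_
  rw [mrep_a_gen K ξ h₁ h₂, mrep_b_gen K ξ h₁ h₂]
  cases ξ i <;> simp

lemma eq_of_mrep_iso {k₁ k₂ k₁' k₂' : Fin (r + 1)} {ξ ξ' : ℕ → Bool} (hk : k₁ ≤ k₂)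
    (hk' : k₁' ≤ k₂') (h : (Mrep K r k₁ k₂ ξ).Iso (Mrep K r k₁' k₂' ξ')) :
    k₁ = k₁' ∧ k₂ = k₂' := by
  have key : ∀ i, (k₁ ≤ i ∧ i ≤ k₂) ↔ (k₁' ≤ i ∧ i ≤ k₂') := fun i => by
    rw [← nontrivial_mrep_iff K k₁ k₂ ξ i, ← nontrivial_mrep_iff K k₁' k₂' ξ' i,
      h.nontrivial_iff i]
  have h1 := (key k₁).1 ⟨le_rfl, hk⟩
  have h2 := (key k₂).1 ⟨hk, le_rfl⟩
  have h3 := (key k₁').2 ⟨le_rfl, hk'⟩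
  have h4 := (key k₂').2 ⟨hk', le_rfl⟩
  exact ⟨le_antisymm h3.1 h1.1, le_antisymm h2.2 h4.2⟩

lemma eq_of_mrep_iso_same_interval {k₁ k₂ : Fin (r + 1)} {ξ ξ' : ℕ → Bool}
    (h : (Mrep K r k₁ k₂ ξ).Iso (Mrep K r k₁ k₂ ξ')) {i : Fin r} (h₁ : k₁ ≤ i.castSucc)
    (h₂ : i.succ ≤ k₂) : ξ i = ξ' i := by
  obtain ⟨f, hfa, hfb⟩ := h
  have hs : mrepGen K r k₁ k₂ ξ i.succ ≠ 0 :=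
    (mrepGen_ne_zero_iff ..).2 ⟨h₁.trans Fin.castSucc_lt_succ.le, h₂⟩
  have hc : mrepGen K r k₁ k₂ ξ i.castSucc ≠ 0 :=
    (mrepGen_ne_zero_iff ..).2 ⟨h₁, Fin.castSucc_lt_succ.le.trans h₂⟩
  have ha := mrep_a_gen K ξ h₁ h₂
  have hb := mrep_b_gen K ξ h₁ h₂
  have ha' := mrep_a_gen K ξ' h₁ h₂
  have hb' := mrep_b_gen K ξ' h₁ h₂
  cases hξ : ξ i <;> cases hξ' : ξ' i <;> simp only [hξ, hξ', if_true, if_false, one_smul,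
    zero_smul, Bool.false_eq_true] at ha hb ha' hb' ⊢
  · have h0 := (isGen_mrepGen K k₁ k₂ ξ' i.succ).linearMap_eq_zero hb'
    refine absurd ((f _).map_eq_zero_iff.1 ?_) hc
    rw [← hb, hfb, h0, LinearMap.zero_apply]
  · have h0 := (isGen_mrepGen K k₁ k₂ ξ' i.castSucc).linearMap_eq_zero ha'
    refine absurd ((f _).map_eq_zero_iff.1 ?_) hs
    rw [← ha, hfa, h0, LinearMap.zero_apply]

lemma ARep.Indec.iso_srep_or_iso_mrep {M : ARep K r} (hM : M.Indec) :
    (∃ j, M.Iso (Srep K r j)) ∨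
      ∃ (k₁ k₂ : Fin (r + 1)) (ξ : ℕ → Bool), k₁ < k₂ ∧ M.Iso (Mrep K r k₁ k₂ ξ) := by
  classical
  obtain ⟨k₁, k₂, hk, hsupp, hedge⟩ := hM.exists_interval
  obtain ⟨g, hg, hgab⟩ := ARep.exists_isGen hM.finrank_le_one
  have h0 : ∀ i, g i ≠ 0 ↔ k₁ ≤ i ∧ i ≤ k₂ := fun i => (hg i).nontrivial_iff.symm.trans (hsupp i)
  rcases hk.eq_or_lt with rfl | hlt
  · have hempty : ∀ i : Fin r, g i.castSucc ≠ 0 → g i.succ ≠ 0 → False := fun i h h' =>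
      absurd (((h0 _).1 h).1.trans_lt Fin.castSucc_lt_succ) ((h0 _).1 h').2.not_gt
    refine .inl ⟨k₁, ARep.iso_of_isGen hg (isGen_srepGen K k₁) (fun i => ?_)
      (fun i h h' => (hempty i h h').elim) fun i h h' => (hempty i h h').elim⟩
    rw [← not_iff_not, ← ne_eq, ← ne_eq, h0, srepGen_ne_zero_iff, le_antisymm_iff, and_comm]
  · refine .inr ⟨k₁, k₂, fun n => decide (∃ h : n < r, M.a ⟨n, h⟩ ≠ 0), hlt,
      ARep.iso_of_isGen hg (isGen_mrepGen K k₁ k₂ _) (fun i => ?_) (fun i h h' => ?_)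
      fun i h h' => ?_⟩
    · rw [← not_iff_not, ← ne_eq, ← ne_eq, h0, mrepGen_ne_zero_iff]
    · refine ⟨_, ?_, mrep_a_gen K _ ((h0 _).1 h).1 ((h0 _).1 h').2⟩
      by_cases ha : M.a i = 0
      · simp [ha]
      · simp [ha, (hgab i).1 ha]
    · refine ⟨_, ?_, mrep_b_gen K _ ((h0 _).1 h).1 ((h0 _).1 h').2⟩
      by_cases ha : M.a i = 0
      · have hb := (hedge i ((h0 _).1 h).1 ((h0 _).1 h').2).resolve_left (not_not.2 ha)
        simp [ha, (hgab i).2 hb]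
      · have hba : M.b i (M.a i (g i.castSucc)) = 0 := LinearMap.congr_fun (M.hba i) _
        simp [ha, ← (hgab i).1 ha, hba]

end Models

/-- Classification of the indecomposable representations of the quiver `A` with
relations `a_i b_i = b_i a_i = 0`: they are exactly the simple modules `S_j` and the
modules `M(k₁,k₂,ξ)` with `k₁ < k₂` and `ξ : (k₁,…,k₂-1) → (0,1)`, and these are
pairwise non-isomorphic. -/
theorem A_quiver_classification (K : Type) [Field K] (r : ℕ) :
    (∀ M : ARep K r, M.Indec →
      (∃ j, M.Iso (Srep K r j)) ∨
      (∃ (k₁ k₂ : Fin (r + 1)) (ξ : ℕ → Bool), k₁ < k₂ ∧ M.Iso (Mrep K r k₁ k₂ ξ))) ∧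
    (∀ j, (Srep K r j).Indec) ∧
    (∀ k₁ k₂ ξ, k₁ < k₂ → (Mrep K r k₁ k₂ ξ).Indec) ∧
    (∀ j j', (Srep K r j).Iso (Srep K r j') → j = j') ∧
    (∀ j k₁ k₂ ξ, k₁ < k₂ → ¬ (Srep K r j).Iso (Mrep K r k₁ k₂ ξ)) ∧
    (∀ k₁ k₂ ξ k₁' k₂' ξ', k₁ < k₂ → k₁' < k₂' →
      (Mrep K r k₁ k₂ ξ).Iso (Mrep K r k₁' k₂' ξ') →
      k₁ = k₁' ∧ k₂ = k₂' ∧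
        ∀ i : ℕ, (k₁ : ℕ) ≤ i → i < (k₂ : ℕ) → ξ i = ξ' i) := by
  refine ⟨fun M hM => hM.iso_srep_or_iso_mrep, srep_indec K,
    fun k₁ k₂ ξ hk => mrep_indec K ξ hk.le, fun j j' h => ?_, fun j k₁ k₂ ξ hk h => ?_,
    fun k₁ k₂ ξ k₁' k₂' ξ' hk hk' h => ?_⟩
  · rw [← nontrivial_srep_iff K j' j, ← h.nontrivial_iff j, nontrivial_srep_iff]
  · have key : ∀ i, i = j ↔ k₁ ≤ i ∧ i ≤ k₂ := fun i => by
      rw [← nontrivial_srep_iff K j i, ← nontrivial_mrep_iff K k₁ k₂ ξ i, h.nontrivial_iff i]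
    have h₁ := (key k₁).2 ⟨le_rfl, hk.le⟩
    have h₂ := (key k₂).2 ⟨hk.le, le_rfl⟩
    exact hk.ne (h₁.trans h₂.symm)
  · obtain ⟨rfl, rfl⟩ := eq_of_mrep_iso K hk.le hk'.le h
    refine ⟨rfl, rfl, fun i h₁ h₂ => ?_⟩
    have hi : i < r := h₂.trans_le (Nat.le_of_lt_succ k₂.2)
    exact eq_of_mrep_iso_same_interval K h (i := ⟨i, hi⟩) h₁ h₂
end
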